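/- arXiv:2006.00051 — 6 statements merged into one kernel-verified Lean document; each statement's English description precedes it below -/
import Mathlib

section
/- Let k be an algebraically closed field of characteristic 0 and let d ≥ 2. For i = 1, 2 let f_i = (P_i, Q_i) be a polynomial self-map of k² with max(deg P_i, deg Q_i) = d such that the homogeneous parts of degree d of P_i and Q_i have no common zero in k²∖{(0,0)} (equivalently, f_i extends to an endomorphism of P²_k of degree d). Let h be a polynomial automorphism of k² (a polynomial self-map admitting a polynomial inverse) such that h ∘ f₁ = f₂ ∘ h. Then deg h = 1, i.e. h is an affine automorphism of k². -/
open MvPolynomial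

namespace MvPolynomial

section TopForm

variable {σ τ R : Type*} [CommRing R]

/-- `g` is the (possibly zero) component of weight `D` of `f`, and `f` has weighted degree at most
`D` with respect to the weights `w`. -/
def HasTopForm (w : σ → ℕ) (D : ℕ) (f g : MvPolynomial σ R) : Prop :=
  (∀ a, coeff a f ≠ 0 → Finsupp.weight w a ≤ D) ∧
    ∀ a, coeff a g = if Finsupp.weight w a = D then coeff a f else 0

namespace HasTopForm

variable {w : σ → ℕ} {D E : ℕ} {f g f' g' : MvPolynomial σ R}

lemma isWeightedHomogeneous (h : HasTopForm w D f g) : IsWeightedHomogeneous w g D := by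
  intro a ha
  rw [h.2] at ha
  by_contra hne
  exact ha (if_neg hne)

lemma coeff_ne_zero (h : HasTopForm w D f g) {a : σ →₀ ℕ} (ha : coeff a g ≠ 0) :
    coeff a f ≠ 0 := by
  rw [h.2] at ha
  split_ifs at ha with hw
  · exact ha
  · exact absurd rfl ha

lemma exists_of_le (h : ∀ a, coeff a f ≠ 0 → Finsupp.weight w a ≤ D) :
    ∃ g, HasTopForm w D f g := by
  classical
  exact ⟨weightedHomogeneousComponent w D f, h, fun a => coeff_weightedHomogeneousComponent D f a⟩

lemma exists_of_weightedTotalDegree_le (h : weightedTotalDegree w f ≤ D) :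
    ∃ g, HasTopForm w D f g :=
  exists_of_le fun _ ha => (le_weightedTotalDegree w (mem_support_iff.2 ha)).trans h

/-- A nonzero polynomial has a nonzero form of top weight. -/
lemma exists_ne_zero (w : σ → ℕ) (hf : f ≠ 0) :
    ∃ g, g ≠ 0 ∧ HasTopForm w (weightedTotalDegree w f) f g := by
  obtain ⟨g, hg⟩ := exists_of_weightedTotalDegree_le (w := w) (f := f) le_rfl
  refine ⟨g, ?_, hg⟩
  rintro rfl
  obtain ⟨a, ha, hmax⟩ := Finset.exists_mem_eq_sup f.support (support_nonempty.2 hf)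
    (fun s => Finsupp.weight w s)
  have := hg.2 a
  rw [if_pos (show Finsupp.weight w a = weightedTotalDegree w f from hmax.symm),
    coeff_zero] at this
  exact mem_support_iff.1 ha this.symm

lemma of_lt (h : HasTopForm w D f g) (hDE : D < E) : HasTopForm w E f 0 := by
  refine ⟨fun a ha => (h.1 a ha).trans hDE.le, fun a => ?_⟩
  split_ifs with hw
  · rw [coeff_zero]
    by_contra hne
    have := h.1 a (Ne.symm hne)
    omega
  · simp

lemma unique (h : HasTopForm w D f g) (h' : HasTopForm w D f g') : g = g' := by
  ext a
  rw [h.2, h'.2]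

lemma eq_zero_of_lt (h : HasTopForm w D f g) (h' : HasTopForm w E f g') (hED : E < D) : g = 0 :=
  h.unique (h'.of_lt hED)

lemma add (h : HasTopForm w D f g) (h' : HasTopForm w D f' g') :
    HasTopForm w D (f + f') (g + g') := by
  refine ⟨fun a ha => ?_, fun a => ?_⟩
  · by_cases h0 : coeff a f = 0
    · refine h'.1 a fun h1 => ha ?_
      simp [h0, h1]
    · exact h.1 a h0
  · rw [coeff_add, coeff_add, h.2, h'.2]
    split_ifs <;> simp

lemma C_mul (r : R) (h : HasTopForm w D f g) : HasTopForm w D (C r * f) (C r * g) := by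
  refine ⟨fun a ha => h.1 a fun h0 => ha ?_, fun a => ?_⟩
  · simp [coeff_C_mul, h0]
  · rw [coeff_C_mul, coeff_C_mul, h.2]
    split_ifs <;> simp

lemma zero (w : σ → ℕ) (D : ℕ) : HasTopForm w D (0 : MvPolynomial σ R) 0 :=
  ⟨fun a ha => absurd (coeff_zero a) ha, fun a => by simp⟩

lemma of_isWeightedHomogeneous (h : IsWeightedHomogeneous w f D) : HasTopForm w D f f := by
  refine ⟨fun a ha => (h ha).le, fun a => ?_⟩
  split_ifs with hw
  · rfl
  · by_contra hne
    exact hw (h hne)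

lemma mul (h : HasTopForm w D f g) (h' : HasTopForm w E f' g') :
    HasTopForm w (D + E) (f * f') (g * g') := by
  classical
  refine ⟨fun a ha => ?_, fun a => ?_⟩
  · rw [coeff_mul] at ha
    obtain ⟨p, hp, hne⟩ := Finset.exists_ne_zero_of_sum_ne_zero ha
    rw [← Finset.HasAntidiagonal.mem_antidiagonal.1 hp, map_add]
    exact add_le_add (h.1 _ (left_ne_zero_of_mul hne)) (h'.1 _ (right_ne_zero_of_mul hne))
  · split_ifs with hw
    · rw [coeff_mul, coeff_mul]
      refine Finset.sum_congr rfl fun p hp => ?_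
      rw [← Finset.HasAntidiagonal.mem_antidiagonal.1 hp, map_add] at hw
      rw [h.2, h'.2]
      by_cases h0 : coeff p.1 f = 0
      · simp [h0]
      by_cases h1 : coeff p.2 f' = 0
      · simp [h1]
      have h2 := h.1 _ h0
      have h3 := h'.1 _ h1
      rw [if_pos (by omega), if_pos (by omega)]
    · by_contra hne
      exact hw ((h.isWeightedHomogeneous.mul h'.isWeightedHomogeneous) hne)

lemma one (w : σ → ℕ) : HasTopForm w 0 (1 : MvPolynomial σ R) 1 :=
  of_isWeightedHomogeneous (isWeightedHomogeneous_one R w)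

lemma pow (h : HasTopForm w D f g) (n : ℕ) : HasTopForm w (n * D) (f ^ n) (g ^ n) := by
  induction n with
  | zero => simpa using one w
  | succ n ih => simpa [pow_succ, add_mul] using ih.mul h

lemma sum {ι : Type*} (s : Finset ι) {F G : ι → MvPolynomial σ R}
    (h : ∀ i ∈ s, HasTopForm w D (F i) (G i)) :
    HasTopForm w D (∑ i ∈ s, F i) (∑ i ∈ s, G i) := by
  classical
  induction s using Finset.induction_on with
  | empty => simpa using zero w D
  | insert i s hi ih =>
    rw [Finset.sum_insert hi, Finset.sum_insert hi]
    exact (h i (Finset.mem_insert_self i s)).add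
      (ih fun j hj => h j (Finset.mem_insert_of_mem hj))

lemma prod {ι : Type*} (s : Finset ι) {F G : ι → MvPolynomial σ R} {e : ι → ℕ}
    (h : ∀ i ∈ s, HasTopForm w (e i) (F i) (G i)) :
    HasTopForm w (∑ i ∈ s, e i) (∏ i ∈ s, F i) (∏ i ∈ s, G i) := by
  classical
  induction s using Finset.induction_on with
  | empty => simpa using one w
  | insert i s hi ih =>
    rw [Finset.sum_insert hi, Finset.prod_insert hi, Finset.prod_insert hi]
    exact (h i (Finset.mem_insert_self i s)).mul
      (ih fun j hj => h j (Finset.mem_insert_of_mem hj))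

/-- Top forms are compatible with substitution. -/
lemma aeval {u : τ → ℕ} {F G : τ → MvPolynomial σ R} (hFG : ∀ i, HasTopForm w (u i) (F i) (G i))
    {p q : MvPolynomial τ R} (hpq : HasTopForm u D p q) :
    HasTopForm w D (MvPolynomial.aeval F p) (MvPolynomial.aeval G q) := by
  classical
  have hq : q = ∑ a ∈ p.support, if Finsupp.weight u a = D then monomial a (coeff a p) else 0 := by
    ext b
    rw [hpq.2, coeff_sum]
    by_cases hb : b ∈ p.support
    · rw [Finset.sum_eq_single b]
      · split_ifs <;> simp
      · intro c _ hc
        split_ifs <;> simp [coeff_monomial, hc]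
      · exact fun h => absurd hb h
    · rw [Finset.sum_eq_zero]
      · simp [notMem_support_iff.1 hb]
      · intro c hc
        have hcb : c ≠ b := fun h => hb (h ▸ hc)
        split_ifs <;> simp [coeff_monomial, hcb]
  rw [hq, p.as_sum, map_sum, map_sum, ← p.as_sum]
  refine sum _ fun a ha => ?_
  have hmon : HasTopForm w (Finsupp.weight u a) (MvPolynomial.aeval F (monomial a (coeff a p)))
      (MvPolynomial.aeval G (monomial a (coeff a p))) := by
    rw [aeval_monomial, aeval_monomial]
    refine C_mul _ ?_
    rw [Finsupp.weight_apply, Finsupp.prod, Finsupp.prod, Finsupp.sum]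
    exact prod _ fun i _ => (hFG i).pow (a i)
  have hle := hpq.1 a (mem_support_iff.1 ha)
  split_ifs with hw
  · rwa [hw] at hmon
  · rw [map_zero]
    exact hmon.of_lt (lt_of_le_of_ne hle hw)

lemma map_algHom {u : τ → ℕ} {θ : MvPolynomial τ R →ₐ[R] MvPolynomial σ R}
    {G : τ → MvPolynomial σ R} (hG : ∀ i, HasTopForm w (u i) (θ (MvPolynomial.X i)) (G i))
    {p q : MvPolynomial τ R} (hpq : HasTopForm u D p q) :
    HasTopForm w D (θ p) (MvPolynomial.aeval G q) := by
  rw [show θ p = MvPolynomial.aeval (fun i => θ (MvPolynomial.X i)) p from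
    congrArg (fun η : _ →ₐ[R] _ => η p) (aeval_unique θ)]
  exact aeval hG hpq

lemma X (w : σ → ℕ) (i : σ) : HasTopForm w (w i) (MvPolynomial.X i : MvPolynomial σ R)
    (MvPolynomial.X i) :=
  of_isWeightedHomogeneous (isWeightedHomogeneous_X R w i)

lemma mul_weight (h : HasTopForm w D f g) {d : ℕ} (hd : 0 < d) :
    HasTopForm (fun i => d * w i) (d * D) f g := by
  have key : ∀ a : σ →₀ ℕ, Finsupp.weight (fun i => d * w i) a = d * Finsupp.weight w a := by
    intro a
    simp [Finsupp.weight_apply, Finsupp.sum, Finset.mul_sum, mul_left_comm]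
  refine ⟨fun a ha => ?_, fun a => ?_⟩
  · rw [key]
    exact Nat.mul_le_mul_left d (h.1 a ha)
  · rw [key, h.2]
    simp [hd.ne']

lemma map_algHom_const {n : ℕ} {θ : MvPolynomial τ R →ₐ[R] MvPolynomial σ R}
    {G : τ → MvPolynomial σ R} (hG : ∀ i, HasTopForm w E (θ (MvPolynomial.X i)) (G i))
    (hE : 0 < E) {p q : MvPolynomial τ R} (hpq : HasTopForm (fun _ => 1) n p q) :
    HasTopForm w (E * n) (θ p) (MvPolynomial.aeval G q) :=
  map_algHom (u := fun _ => E * 1) (by simpa using hG) (hpq.mul_weight hE)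

end HasTopForm

end TopForm

lemma IsWeightedHomogeneous.aeval_smul {σ R S : Type*} [CommRing R] [CommRing S] [Algebra R S]
    {w : σ → ℕ} {K : ℕ} {φ : MvPolynomial σ R} (h : IsWeightedHomogeneous w φ K) (s : S)
    (v : σ → S) : aeval (fun i => s ^ w i * v i) φ = s ^ K * aeval v φ := by
  rw [aeval_def, aeval_def, eval₂_eq, eval₂_eq, Finset.mul_sum]
  refine Finset.sum_congr rfl fun a ha => ?_
  have hK : s ^ K = ∏ i ∈ a.support, (s ^ w i) ^ a i := by
    rw [← h (mem_support_iff.1 ha), Finsupp.weight_apply, Finsupp.sum, ← Finset.prod_pow_eq_pow_sum]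
    exact Finset.prod_congr rfl fun i _ => by rw [smul_eq_mul, mul_comm, pow_mul]
  simp_rw [mul_pow]
  rw [Finset.prod_mul_distrib, hK]
  ring

section Fin2

variable {R : Type*} [CommRing R]

lemma weight_fin_two (w : Fin 2 → ℕ) (a : Fin 2 →₀ ℕ) :
    Finsupp.weight w a = a 0 * w 0 + a 1 * w 1 := by
  simp [Finsupp.weight_eq_sum, Fin.sum_univ_two]

lemma map_aeval_pair {S T : Type*} [CommRing S] [CommRing T] [Algebra R S] [Algebra R T]
    (θ : S →ₐ[R] T) (x y : S) (p : MvPolynomial (Fin 2) R) :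
    θ (aeval ![x, y] p) = aeval ![θ x, θ y] p := by
  rw [← AlgHom.comp_apply, comp_aeval]
  congr 2
  ext i
  fin_cases i <;> rfl

lemma aeval_pair_smul {S : Type*} [CommRing S] [Algebra R S] {w : Fin 2 → ℕ} {K : ℕ}
    {φ : MvPolynomial (Fin 2) R} (h : IsWeightedHomogeneous w φ K) (s x y : S) :
    aeval ![s ^ w 0 * x, s ^ w 1 * y] φ = s ^ K * aeval ![x, y] φ := by
  rw [← h.aeval_smul]
  congr 2
  ext i
  fin_cases i <;> rfl

lemma aeval_aeval_C_X {S : Type*} [CommRing S] [Algebra R S] (φ : MvPolynomial (Fin 2) R) (y : S) :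
    Polynomial.aeval y (aeval ![Polynomial.C 1, Polynomial.X] φ : Polynomial R) =
      aeval ![1, y] φ := by
  rw [map_aeval_pair, Polynomial.aeval_X, map_one, map_one]

lemma aeval_C_X_eq_sum (c : R) (φ : MvPolynomial (Fin 2) R) :
    aeval ![Polynomial.C c, Polynomial.X] φ =
      ∑ a ∈ φ.support, Polynomial.monomial (a 1) (coeff a φ * c ^ a 0) := by
  rw [aeval_def, eval₂_eq']
  refine Finset.sum_congr rfl fun a _ => ?_
  simp only [Fin.prod_univ_two, Matrix.cons_val_zero, Matrix.cons_val_one,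
    ← Polynomial.C_mul_X_pow_eq_monomial, Polynomial.algebraMap_eq, map_mul, map_pow]
  ring

/-- Setting the first variable of a weighted homogeneous polynomial in two variables to a constant
keeps track of all coefficients. -/
lemma IsWeightedHomogeneous.coeff_aeval_C_X {w : Fin 2 → ℕ} {K : ℕ} {φ : MvPolynomial (Fin 2) R}
    (h : IsWeightedHomogeneous w φ K) (hw : 0 < w 0) (c : R) {a : Fin 2 →₀ ℕ}
    (ha : coeff a φ ≠ 0) :
    (aeval ![Polynomial.C c, Polynomial.X] φ : Polynomial R).coeff (a 1) =
      coeff a φ * c ^ a 0 := by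
  rw [aeval_C_X_eq_sum, Polynomial.finsetSum_coeff, Finset.sum_eq_single a]
  · simp
  · intro b hb hba
    rw [Polynomial.coeff_monomial, if_neg]
    intro h1
    apply hba
    have h2 := h (mem_support_iff.1 hb)
    rw [← h ha, weight_fin_two, weight_fin_two, h1] at h2
    ext i
    fin_cases i
    · exact Nat.eq_of_mul_eq_mul_right hw (by simpa using h2)
    · exact h1
  · intro hna
    exact absurd (mem_support_iff.2 ha) hna

lemma exists_coeff_of_coeff_aeval_C_X_ne_zero {c : R} {φ : MvPolynomial (Fin 2) R} {j : ℕ}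
    (hj : (aeval ![Polynomial.C c, Polynomial.X] φ : Polynomial R).coeff j ≠ 0) :
    ∃ a, coeff a φ ≠ 0 ∧ a 1 = j := by
  rw [aeval_C_X_eq_sum, Polynomial.finsetSum_coeff] at hj
  obtain ⟨a, ha, hne⟩ := Finset.exists_ne_zero_of_sum_ne_zero hj
  refine ⟨a, mem_support_iff.1 ha, ?_⟩
  by_contra h
  exact hne (by rw [Polynomial.coeff_monomial, if_neg h])

lemma IsWeightedHomogeneous.aeval_C_X_ne_zero [IsDomain R] {w : Fin 2 → ℕ} {K : ℕ}
    {φ : MvPolynomial (Fin 2) R} (h : IsWeightedHomogeneous w φ K) (hw : 0 < w 0) {c : R}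
    (hc : c ≠ 0) (hφ : φ ≠ 0) :
    (aeval ![Polynomial.C c, Polynomial.X] φ : Polynomial R) ≠ 0 := by
  obtain ⟨a, ha⟩ := ne_zero_iff.1 hφ
  intro h0
  have := h.coeff_aeval_C_X hw c ha
  rw [h0, Polynomial.coeff_zero] at this
  exact mul_ne_zero ha (pow_ne_zero _ hc) this.symm

end Fin2

section AlgClosed

variable {k : Type*} [Field k] [IsAlgClosed k]

/-- Two polynomials satisfying a homogeneous relation are proportional. -/
lemma exists_proportional_of_aeval_eq_zero {σ : Type*} {n : ℕ} {F : MvPolynomial (Fin 2) k}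
    (hF : IsWeightedHomogeneous (fun _ => 1) F n) (hF0 : F ≠ 0) {A B : MvPolynomial σ k}
    (hAB : aeval ![A, B] F = 0) :
    ∃ (α β : k) (φ : MvPolynomial σ k), (α ≠ 0 ∨ β ≠ 0) ∧ A = C α * φ ∧ B = C β * φ := by
  by_cases hA : A = 0
  · exact ⟨0, 1, B, Or.inr one_ne_zero, by simp [hA], by simp⟩
  let L := FractionRing (MvPolynomial σ k)
  let ι : MvPolynomial σ k →ₐ[k] L := IsScalarTower.toAlgHom k _ L
  have hι : Function.Injective ι := IsFractionRing.injective (MvPolynomial σ k) L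
  have hA' : ι A ≠ 0 := fun h => hA (hι (by simpa using h))
  set t := ι B / ι A with ht
  set p : Polynomial k := aeval ![Polynomial.C 1, Polynomial.X] F with hp
  have hp0 : p ≠ 0 := hF.aeval_C_X_ne_zero one_pos one_ne_zero hF0
  have h1 : Polynomial.aeval t p = aeval ![1, t] F := aeval_aeval_C_X F t
  have h2 : aeval ![ι A, ι B] F = (ι A) ^ n * aeval ![1, t] F := by
    rw [← aeval_pair_smul hF, pow_one, mul_one, ht, mul_div_cancel₀ _ hA']
  have h3 : aeval ![ι A, ι B] F = 0 := by
    rw [← map_aeval_pair, hAB, map_zero]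
  have h4 : Polynomial.aeval t p = 0 := by
    rw [h1]
    exact (mul_eq_zero.1 (h2.symm.trans h3)).resolve_left (pow_ne_zero _ hA')
  rw [(IsAlgClosed.splits p).eq_prod_roots, map_mul, Polynomial.aeval_C, mul_eq_zero,
    map_multiset_prod, Multiset.prod_eq_zero_iff] at h4
  rcases h4 with h4 | h4
  · exact absurd ((map_eq_zero _).1 h4) (Polynomial.leadingCoeff_ne_zero.2 hp0)
  · simp only [Multiset.map_map, Multiset.mem_map, Function.comp_apply, map_sub,
      Polynomial.aeval_X, Polynomial.aeval_C] at h4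
    obtain ⟨r, -, hr⟩ := h4
    refine ⟨1, r, A, Or.inl one_ne_zero, by simp, hι ?_⟩
    have h5 : ι B = t * ι A := by rw [ht, div_mul_cancel₀ _ hA']
    rw [h5, sub_eq_zero.1 hr, map_mul]
    rfl

/-- A binary form of positive degree over an algebraically closed field has a nontrivial zero. -/
lemma exists_ne_zero_eval_eq_zero {d : ℕ} (hd : 0 < d) {ψ : MvPolynomial (Fin 2) k}
    (h : IsWeightedHomogeneous (fun _ => 1) ψ d) : ∃ v : Fin 2 → k, v ≠ 0 ∧ eval v ψ = 0 := by
  set p : Polynomial k := aeval ![Polynomial.C 1, Polynomial.X] ψ with hp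
  by_cases hdeg : p.degree = 0
  · refine ⟨![0, 1], fun h0 => one_ne_zero (congrFun h0 1), ?_⟩
    rw [eval_eq']
    refine Finset.sum_eq_zero fun a ha => ?_
    have hw := h (mem_support_iff.1 ha)
    rw [weight_fin_two] at hw
    by_cases h0 : a 0 = 0
    · exfalso
      have := h.coeff_aeval_C_X one_pos 1 (mem_support_iff.1 ha)
      rw [← hp, Polynomial.coeff_eq_zero_of_degree_lt, one_pow, mul_one] at this
      · exact mem_support_iff.1 ha this.symm
      · rw [hdeg]
        exact_mod_cast (show 0 < a 1 by omega)
    · simp [Fin.prod_univ_two, h0]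
  · obtain ⟨x, hx⟩ := IsAlgClosed.exists_root p hdeg
    refine ⟨![1, x], fun h0 => one_ne_zero (congrFun h0 0), ?_⟩
    rw [← aeval_eq_eval, ← aeval_aeval_C_X, Polynomial.coe_aeval_eq_eval]
    exact hx

/-- A polynomial whose zero set is totally invariant under a polynomial of degree at least two
has only one root. -/
lemma exists_eq_C_mul_X_sub_C_pow [CharZero k] {d : ℕ} (hd : 2 ≤ d) {p q : Polynomial k} {c : k}
    (hc : c ≠ 0) (hp : 0 < p.natDegree) (h : p.comp q = Polynomial.C c * p ^ d) :
    ∃ γ t : k, p = Polynomial.C γ * (Polynomial.X - Polynomial.C t) ^ p.natDegree := by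
  have hp0 : p ≠ 0 := by rintro rfl; simp at hp
  have hq : q.natDegree = d := by
    have := congrArg Polynomial.natDegree h
    rw [Polynomial.natDegree_comp, Polynomial.natDegree_C_mul hc, Polynomial.natDegree_pow,
      mul_comm d] at this
    exact Nat.eq_of_mul_eq_mul_left hp this
  have hroot : ∀ x, p.IsRoot x ↔ p.IsRoot (q.eval x) := by
    intro x
    have := congrArg (Polynomial.eval x) h
    rw [Polynomial.eval_comp] at this
    rw [Polynomial.IsRoot, Polynomial.IsRoot, this]
    simp [hc, show d ≠ 0 by omega]
  have hqC : ∀ z, (q - Polynomial.C z).natDegree = d := fun z => by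
    rw [Polynomial.natDegree_sub_C, hq]
  have hex : ∀ z, ∃ y, q.eval y = z := fun z => by
    obtain ⟨y, hy⟩ := IsAlgClosed.exists_root (q - Polynomial.C z) (fun h0 => by
      have := hqC z
      rw [Polynomial.natDegree_eq_of_degree_eq_some (n := 0) h0] at this
      omega)
    exact ⟨y, by simpa [sub_eq_zero] using hy⟩
  let Z := {x // p.IsRoot x}
  have : Finite Z := (Polynomial.finite_setOfPred_isRoot hp0).to_subtype
  let F : Z → Z := fun x => ⟨q.eval x.1, (hroot x.1).1 x.2⟩
  have hF : Function.Surjective F := by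
    rintro ⟨z, hz⟩
    obtain ⟨y, rfl⟩ := hex z
    exact ⟨⟨y, (hroot y).2 hz⟩, rfl⟩
  have hFi : Function.Injective F := Finite.injective_iff_surjective.2 hF
  have hfib : ∀ y, p.IsRoot y → ∃ l : k, l ≠ 0 ∧
      q.derivative = Polynomial.C (l * d) * (Polynomial.X - Polynomial.C y) ^ (d - 1) := by
    intro y hy
    set r := q - Polynomial.C (q.eval y) with hr
    have hr0 : r ≠ 0 := fun h0 => by
      have := hqC (q.eval y)
      rw [← hr, h0, Polynomial.natDegree_zero] at this
      omega
    have hsplit := IsAlgClosed.splits r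
    have hroots : r.roots = Multiset.replicate d y := by
      refine Multiset.eq_replicate.2 ⟨by rw [← hsplit.natDegree_eq_card_roots]; exact hqC _, ?_⟩
      intro x hx
      have hx' : q.eval x = q.eval y := by
        have := (Polynomial.mem_roots hr0).1 hx
        simpa [hr, sub_eq_zero] using this
      have hxr : p.IsRoot x := (hroot x).2 (hx' ▸ (hroot y).1 hy)
      exact congrArg Subtype.val (@hFi ⟨x, hxr⟩ ⟨y, hy⟩ (Subtype.ext hx'))
    have heq := hsplit.eq_prod_roots
    rw [hroots, Multiset.map_replicate, Multiset.prod_replicate] at heq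
    refine ⟨r.leadingCoeff, Polynomial.leadingCoeff_ne_zero.2 hr0, ?_⟩
    have hder : q.derivative = r.derivative := by simp [hr]
    rw [hder]
    conv_lhs => rw [heq]
    rw [Polynomial.derivative_C_mul, Polynomial.derivative_X_sub_C_pow]
    simp [mul_assoc]
  obtain ⟨t, ht⟩ := IsAlgClosed.exists_root p (fun h0 => by
    rw [Polynomial.natDegree_eq_of_degree_eq_some (n := 0) h0] at hp
    omega)
  have huniq : ∀ y, p.IsRoot y → y = t := by
    intro y hy
    obtain ⟨l, hl, h1⟩ := hfib y hy
    obtain ⟨l', -, h2⟩ := hfib t ht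
    have h3 := congrArg (Polynomial.eval t) (h1.symm.trans h2)
    have hd1 : d - 1 ≠ 0 := by omega
    have hd0 : (d : k) ≠ 0 := by exact_mod_cast (show d ≠ 0 by omega)
    simp [hl, hd1, hd0] at h3
    exact (sub_eq_zero.1 h3).symm
  have hsplit := IsAlgClosed.splits p
  have hroots : p.roots = Multiset.replicate p.natDegree t :=
    Multiset.eq_replicate.2 ⟨hsplit.natDegree_eq_card_roots.symm,
      fun x hx => huniq x ((Polynomial.mem_roots hp0).1 hx)⟩
  refine ⟨p.leadingCoeff, t, ?_⟩
  conv_lhs => rw [hsplit.eq_prod_roots, hroots, Multiset.map_replicate, Multiset.prod_replicate]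

end AlgClosed

section Automorphism

variable {k : Type*} [Field k]

lemma exists_topForm_pair {σ : Type*} (w : σ → ℕ) {F G : MvPolynomial σ k} (hFG : F ≠ 0 ∨ G ≠ 0) :
    ∃ (K : ℕ) (A B : MvPolynomial σ k),
      (A ≠ 0 ∨ B ≠ 0) ∧ HasTopForm w K F A ∧ HasTopForm w K G B := by
  rcases le_total (weightedTotalDegree w F) (weightedTotalDegree w G) with hle | hle
  · by_cases hG : G = 0
    · obtain ⟨A, hA, hFA⟩ := HasTopForm.exists_ne_zero w (hFG.resolve_right (not_not.2 hG))
      exact ⟨_, A, 0, Or.inl hA, hFA, by rw [hG]; exact HasTopForm.zero w _⟩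
    · obtain ⟨B, hB, hGB⟩ := HasTopForm.exists_ne_zero w hG
      obtain ⟨A, hA⟩ := HasTopForm.exists_of_weightedTotalDegree_le hle
      exact ⟨_, A, B, Or.inr hB, hA, hGB⟩
  · by_cases hF : F = 0
    · obtain ⟨B, hB, hGB⟩ := HasTopForm.exists_ne_zero w (hFG.resolve_left (not_not.2 hF))
      exact ⟨_, 0, B, Or.inr hB, by rw [hF]; exact HasTopForm.zero w _, hGB⟩
    · obtain ⟨A, hA, hFA⟩ := HasTopForm.exists_ne_zero w hF
      obtain ⟨B, hB⟩ := HasTopForm.exists_of_weightedTotalDegree_le hle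
      exact ⟨_, A, B, Or.inl hA, hFA, hB⟩

lemma hasTopForm_totalDegree_le {σ : Type*} {F : MvPolynomial σ k} {n : ℕ}
    (h : F.totalDegree ≤ n) : HasTopForm (fun _ => 1) n F (homogeneousComponent n F) := by
  classical
  refine ⟨fun a ha => ?_, fun a => coeff_weightedHomogeneousComponent n F a⟩
  rw [← Finsupp.degree_eq_weight_one]
  exact (le_totalDegree (mem_support_iff.2 ha)).trans h

lemma exists_topForm_totalDegree {σ : Type*} {F : MvPolynomial σ k} (hF : F ≠ 0) :
    ∃ g, g ≠ 0 ∧ HasTopForm (fun _ => 1) F.totalDegree F g := by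
  have := HasTopForm.exists_ne_zero (fun _ => 1) hF
  rwa [show weightedTotalDegree (fun _ => 1) F = F.totalDegree from weightedTotalDegree_one F]
    at this

lemma HasTopForm.totalDegree_le {σ : Type*} {F g : MvPolynomial σ k} {n : ℕ}
    (h : HasTopForm (fun _ => 1) n F g) : F.totalDegree ≤ n := by
  refine Finset.sup_le fun a ha => ?_
  have := h.1 a (mem_support_iff.1 ha)
  rwa [← Finsupp.degree_eq_weight_one] at this

lemma HasTopForm.totalDegree_lt {σ : Type*} {F : MvPolynomial σ k} {n : ℕ} (hn : 0 < n)
    (h : HasTopForm (fun _ => 1) n F 0) : F.totalDegree < n := by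
  refine (Finset.sup_lt_iff hn).2 fun a ha => ?_
  have h1 := h.1 a (mem_support_iff.1 ha)
  have h2 := h.2 a
  have h3 : Finsupp.weight (fun _ => 1) a ≠ n := by
    intro h3
    rw [if_pos h3, coeff_zero] at h2
    exact mem_support_iff.1 ha h2.symm
  have := lt_of_le_of_ne h1 h3
  rwa [← Finsupp.degree_eq_weight_one] at this

section HeavierFirst

variable {n m d : ℕ} (hmn : m < n)
include hmn

/-- If the first variable is heavier than the second, then the monomial of highest possible weight
in a polynomial of degree at most `d` is the `d`-th power of the first variable. -/
lemma hasTopForm_C_mul_X_pow {P : MvPolynomial (Fin 2) k} (hP : P.totalDegree ≤ d) :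
    ∃ c, HasTopForm ![n, m] (d * n) P (C c * X 0 ^ d) := by
  classical
  have hdeg : ∀ a, coeff a P ≠ 0 → a 0 + a 1 ≤ d := fun a ha => by
    have := (hasTopForm_totalDegree_le hP).1 a ha
    rwa [weight_fin_two, mul_one, mul_one] at this
  refine ⟨coeff (Finsupp.single 0 d) P, fun a ha => ?_, fun a => ?_⟩
  · have := hdeg a ha
    rw [weight_fin_two]
    simp only [Matrix.cons_val_zero, Matrix.cons_val_one]
    nlinarith
  · rw [coeff_C_mul, coeff_X_pow]
    by_cases ha : Finsupp.single 0 d = a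
    · subst ha
      simp [weight_fin_two]
    · rw [if_neg ha, mul_zero]
      split_ifs with hw
      · by_contra hne
        have h1 := hdeg a (Ne.symm hne)
        rw [weight_fin_two] at hw
        simp only [Matrix.cons_val_zero, Matrix.cons_val_one] at hw
        have h2 : a 1 = 0 := by
          by_contra h0
          have : 0 < a 1 := Nat.pos_of_ne_zero h0
          nlinarith
        have h3 : a 0 = d := by
          rw [h2, zero_mul, add_zero] at hw
          exact Nat.eq_of_mul_eq_mul_right (by omega) hw
        apply ha
        ext i
        fin_cases i
        · simpa using h3.symm
        · simpa using h2.symm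
      · rfl

end HeavierFirst

/-- The top forms of the components of an automorphism for any weights are proportional, unless
their weight is too small. -/
lemma exists_proportional_topForms [IsAlgClosed k]
    {h h' : MvPolynomial (Fin 2) k →ₐ[k] MvPolynomial (Fin 2) k}
    (hinv : ∀ p, h' (h p) = p) {n K : ℕ} {w : Fin 2 → ℕ} {a A B : MvPolynomial (Fin 2) k}
    (ha : a ≠ 0) (ha' : HasTopForm (fun _ => 1) n (h (X 0)) a)
    (hA : HasTopForm w K (h' (X 0)) A) (hB : HasTopForm w K (h' (X 1)) B)
    (hK : w 0 < K * n) :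
    ∃ (α β : k) (φ : MvPolynomial (Fin 2) k), (α ≠ 0 ∨ β ≠ 0) ∧ A = C α * φ ∧ B = C β * φ := by
  refine exists_proportional_of_aeval_eq_zero ha'.isWeightedHomogeneous ha ?_
  have hK0 : 0 < K := Nat.pos_of_ne_zero (by rintro rfl; simp at hK)
  have h1 := HasTopForm.map_algHom_const (θ := h') (G := ![A, B])
    (by simpa [Fin.forall_fin_two] using ⟨hA, hB⟩) hK0 ha'
  rw [hinv] at h1
  exact h1.eq_zero_of_lt (HasTopForm.X w 0) hK

/-- A weighted homogeneous relation between nonzero polynomials gives a nonzero root. -/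
lemma exists_root_of_aeval_eq_zero [IsAlgClosed k] {σ : Type*} {w : Fin 2 → ℕ} {K : ℕ}
    {φ : MvPolynomial (Fin 2) k} (hφ : IsWeightedHomogeneous w φ K) (hw : 0 < w 0)
    {a b : MvPolynomial σ k} (ha : a ≠ 0) (hb : b ≠ 0) (hab : aeval ![a, b] φ = 0) :
    ∃ t : k, t ≠ 0 ∧ aeval ![1, t] φ = 0 := by
  have : Infinite k := IsAlgClosed.instInfinite
  obtain ⟨v, hv⟩ : ∃ v, eval v (a * b) ≠ 0 := by
    by_contra! hall
    exact mul_ne_zero ha hb (funext fun v => by rw [hall v, map_zero])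
  rw [map_mul] at hv
  obtain ⟨s, hs⟩ := IsAlgClosed.exists_pow_nat_eq (eval v a) hw
  have hs0 : s ≠ 0 := by
    rintro rfl
    rw [zero_pow hw.ne'] at hs
    exact left_ne_zero_of_mul hv hs.symm
  refine ⟨eval v b / s ^ w 1, div_ne_zero (right_ne_zero_of_mul hv) (pow_ne_zero _ hs0), ?_⟩
  have h1 := congrArg (aeval v) hab
  rw [map_aeval_pair, map_zero, aeval_eq_eval] at h1
  have h2 := aeval_pair_smul hφ s 1 (eval v b / s ^ w 1)
  rw [mul_one, mul_div_cancel₀ _ (pow_ne_zero _ hs0), hs] at h2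
  exact (mul_eq_zero.1 (h2.symm.trans h1)).resolve_left (pow_ne_zero _ hs0)

section Root

variable {w : Fin 2 → ℕ} {K : ℕ} {φ : MvPolynomial (Fin 2) k}
  (hφ : IsWeightedHomogeneous w φ K) (hw : 0 < w 0) (hφ0 : φ ≠ 0) {t : k}
  (ht : aeval ![1, t] φ = 0)
include hφ hw hφ0 ht

lemma natDegree_aeval_C_X_pos :
    0 < (aeval ![Polynomial.C 1, Polynomial.X] φ : Polynomial k).natDegree := by
  have hp0 := hφ.aeval_C_X_ne_zero hw one_ne_zero hφ0
  rw [← aeval_aeval_C_X] at ht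
  refine Polynomial.natDegree_pos_iff_degree_pos.2
    (Polynomial.degree_pos_of_aeval_root hp0 ht fun x hx => by simpa using hx)

/-- A weighted homogeneous polynomial with a nonzero root is not totally invariant under a weighted
homogeneous map whose first component is a power, if the first weight is larger than the
second. -/
lemma aeval_pow_ne_C_mul_pow [IsAlgClosed k] [CharZero k] (hw1 : 0 < w 1) (hlt : w 1 < w 0)
    (ht0 : t ≠ 0) {d : ℕ} (hd : 2 ≤ d) {c c' : k} (hc : c ≠ 0) (hc' : c' ≠ 0)
    (Q : MvPolynomial (Fin 2) k) :
    aeval ![C c * X 0 ^ d, Q] φ ≠ C c' * φ ^ d := by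
  intro heq
  have hpos := natDegree_aeval_C_X_pos hφ hw hφ0 ht
  set δ : MvPolynomial (Fin 2) k →ₐ[k] Polynomial k :=
    aeval ![Polynomial.C 1, Polynomial.X] with hδ
  have hδX : δ (X 0) = 1 := by simp [hδ]
  have hδC : ∀ r, δ (C r) = Polynomial.C r := fun r => by simp [hδ]
  obtain ⟨s, hs⟩ := IsAlgClosed.exists_pow_nat_eq c hw
  have hs0 : s ≠ 0 := by
    rintro rfl
    rw [zero_pow hw.ne'] at hs
    exact hc hs.symm
  have h1 := congrArg δ heq
  rw [map_aeval_pair, map_mul, map_mul, map_pow, map_pow, hδX, hδC, hδC, one_pow] at h1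
  have hq : (Polynomial.C s) ^ w 1 * (Polynomial.C (s ^ w 1)⁻¹ * δ Q) = δ Q := by
    rw [← mul_assoc, ← map_pow, ← map_mul, mul_inv_cancel₀ (pow_ne_zero _ hs0), map_one, one_mul]
  have h2 := aeval_pair_smul hφ (Polynomial.C s) 1 (Polynomial.C (s ^ w 1)⁻¹ * δ Q)
  rw [hq, ← map_pow, hs, h1, ← aeval_aeval_C_X, ← hδ] at h2
  have h3 : (δ φ).comp (Polynomial.C (s ^ w 1)⁻¹ * δ Q) =
      Polynomial.C (c' / s ^ K) * (δ φ) ^ d := by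
    have hsK : s ^ K ≠ 0 := pow_ne_zero _ hs0
    have hCs : (Polynomial.C s) ^ K ≠ 0 := pow_ne_zero _ (by simpa using hs0)
    apply mul_left_cancel₀ hCs
    change _ * Polynomial.aeval (R := k) (Polynomial.C (s ^ w 1)⁻¹ * δ Q) (δ φ) = _
    rw [← h2, ← mul_assoc, ← Polynomial.C_pow, ← Polynomial.C_mul, mul_div_cancel₀ _ hsK]
  obtain ⟨γ, t', h4⟩ := exists_eq_C_mul_X_sub_C_pow hd (div_ne_zero hc' (pow_ne_zero _ hs0)) hpos h3
  set N := (δ φ).natDegree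
  have hne : δ φ ≠ 0 := by
    intro h0
    have : N = 0 := by simp [N, h0]
    omega
  have hγ : γ ≠ 0 := by
    rintro rfl
    exact hne (by simpa using h4)
  have ht' : t' ≠ 0 := by
    rw [← aeval_aeval_C_X, ← hδ, h4] at ht
    simp only [map_mul, map_pow, map_sub, Polynomial.aeval_X, Polynomial.aeval_C,
      Algebra.algebraMap_self, RingHom.id_apply, mul_eq_zero, hγ, false_or] at ht
    rw [← sub_eq_zero.1 (eq_zero_of_pow_eq_zero ht)]
    exact ht0
  have hcoeff : ∀ j, (δ φ).coeff j = γ * ((-t') ^ (N - j) * (N.choose j : k)) := fun j => by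
    rw [h4, Polynomial.coeff_C_mul, sub_eq_add_neg, ← map_neg, Polynomial.coeff_X_add_C_pow]
  have hcne : ∀ j ≤ N, (δ φ).coeff j ≠ 0 := fun j hj => by
    rw [hcoeff]
    exact mul_ne_zero hγ (mul_ne_zero (pow_ne_zero _ (neg_ne_zero.2 ht'))
      (by exact_mod_cast (Nat.choose_pos hj).ne'))
  obtain ⟨a, ha, ha1⟩ := exists_coeff_of_coeff_aeval_C_X_ne_zero (hcne N le_rfl)
  obtain ⟨b, hb, hb1⟩ := exists_coeff_of_coeff_aeval_C_X_ne_zero (hcne (N - 1) (by omega))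
  have hwa := hφ ha
  have hwb := hφ hb
  rw [weight_fin_two] at hwa hwb
  obtain ⟨N', hN'⟩ : ∃ N', N = N' + 1 := ⟨N - 1, by omega⟩
  rw [ha1, hN'] at hwa
  rw [hb1, hN', Nat.add_sub_cancel] at hwb
  have h5 : b 0 * w 0 = a 0 * w 0 + w 1 := by linarith
  have h6 : w 0 ∣ w 1 := (Nat.dvd_add_right (Dvd.intro_left (a 0) rfl)).1
    (h5 ▸ Dvd.intro_left (b 0) rfl)
  exact absurd (Nat.le_of_dvd hw1 h6) (by omega)

end Root

lemma algHom_X_ne_C {σ : Type*} {h h' : MvPolynomial σ k →ₐ[k] MvPolynomial σ k}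
    (hinv : ∀ p, h' (h p) = p) (i : σ) (c : k) : h (X i) ≠ C c := by
  intro h0
  have h1 := hinv (X i)
  rw [h0, ← algebraMap_eq, h'.commutes] at h1
  have h2 := congrArg totalDegree h1
  rw [algebraMap_eq, totalDegree_C, totalDegree_X] at h2
  exact zero_ne_one h2

lemma totalDegree_algHom_X_pos {σ : Type*} {h h' : MvPolynomial σ k →ₐ[k] MvPolynomial σ k}
    (hinv : ∀ p, h' (h p) = p) (i : σ) : 0 < (h (X i)).totalDegree :=
  Nat.pos_of_ne_zero fun h0 => algHom_X_ne_C hinv i _ (totalDegree_eq_zero_iff_eq_C.1 h0)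

lemma two_le_of_hasTopForm {h h' : MvPolynomial (Fin 2) k →ₐ[k] MvPolynomial (Fin 2) k}
    (hinv : ∀ p, h' (h p) = p) {K : ℕ} {w : Fin 2 → ℕ} (hw : 2 ≤ w 0)
    {G : Fin 2 → MvPolynomial (Fin 2) k} (hG : ∀ i, HasTopForm w K (h' (X i)) (G i)) :
    2 ≤ K := by
  by_contra! hK
  have h1 : ∀ i, ∃ g, HasTopForm ![1, 0] 0 (h' (X i)) g := fun i => by
    refine HasTopForm.exists_of_le fun a ha => ?_
    have h2 := (hG i).1 a ha
    rw [weight_fin_two] at h2 ⊢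
    simp only [Matrix.cons_val_zero, Matrix.cons_val_one, mul_one, mul_zero, add_zero]
    nlinarith
  choose g hg using h1
  obtain ⟨q, hq⟩ := HasTopForm.exists_of_le (w := fun _ : Fin 2 => 0) (D := 0) (f := h (X 0))
    fun a _ => by simp [weight_fin_two]
  have h3 := HasTopForm.map_algHom hg hq
  rw [hinv] at h3
  have h4 := h3.1 (Finsupp.single 0 1) (by simp)
  rw [weight_fin_two] at h4
  simp at h4

/-- Linear substitutions do not raise the degree. -/
lemma totalDegree_algHom_le {σ τ : Type*} {e : MvPolynomial σ k →ₐ[k] MvPolynomial τ k}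
    (he : ∀ i, (e (X i)).totalDegree ≤ 1) (p : MvPolynomial σ k) :
    (e p).totalDegree ≤ p.totalDegree := by
  have := HasTopForm.map_algHom_const (fun i => hasTopForm_totalDegree_le (he i)) one_pos
    (hasTopForm_totalDegree_le (le_refl p.totalDegree))
  rw [one_mul] at this
  exact this.totalDegree_le

section Conjugation

variable {f₁ f₂ h h' : MvPolynomial (Fin 2) k →ₐ[k] MvPolynomial (Fin 2) k}
  (hinv : ∀ p, h' (h p) = p) (hinv' : ∀ p, h (h' p) = p) (hconj : ∀ p, f₁ (h p) = h (f₂ p))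
  {d : ℕ} (hd : 2 ≤ d) (hf₁ : ∀ i, (f₁ (X i)).totalDegree ≤ d)
  (hnz : ∀ v : Fin 2 → k, v ≠ 0 → ¬(eval v (homogeneousComponent d (f₁ (X 0))) = 0 ∧
    eval v (homogeneousComponent d (f₁ (X 1))) = 0))

include hd hnz in
lemma aeval_homogeneousComponent_ne_zero [IsAlgClosed k] {n : ℕ} {a : MvPolynomial (Fin 2) k}
    (ha : a ≠ 0) (han : IsWeightedHomogeneous (fun _ => 1) a n) :
    aeval ![homogeneousComponent d (f₁ (X 0)), homogeneousComponent d (f₁ (X 1))] a ≠ 0 := by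
  intro h0
  obtain ⟨α, β, ψ, hαβ, h1, h2⟩ := exists_proportional_of_aeval_eq_zero han ha h0
  have hψ : IsWeightedHomogeneous (fun _ => 1) ψ d := by
    have key : ∀ (r : k) (p : MvPolynomial (Fin 2) k), r ≠ 0 →
        homogeneousComponent d p = C r * ψ → IsWeightedHomogeneous (fun _ => 1) ψ d := by
      intro r p hr hp b hb
      have := weightedHomogeneousComponent_isWeightedHomogeneous (w := 1) d p
      refine this (d := b) ?_
      change coeff b (homogeneousComponent d p) ≠ 0
      rw [hp, coeff_C_mul]
      exact mul_ne_zero hr hb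
    rcases hαβ with hα | hβ
    · exact key α _ hα h1
    · exact key β _ hβ h2
  obtain ⟨v, hv, hv0⟩ := exists_ne_zero_eval_eq_zero (by omega) hψ
  exact hnz v hv (by simp [h1, h2, hv0])

include hinv hinv' hconj hd hf₁ hnz

/-- If the first component of a conjugating automorphism had larger degree than the second, then,
for these degrees as weights, the top forms of the inverse would be multiples of a single form that
is totally invariant under the top part of the second map, which is impossible. -/
theorem not_totalDegree_lt_of_conj [IsAlgClosed k] [CharZero k]
    (hf₂ : ∀ i, (f₂ (X i)).totalDegree ≤ d) :
    ¬ (h (X 1)).totalDegree < (h (X 0)).totalDegree := by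
  intro hmn
  have hconj' : ∀ p, f₂ (h' p) = h' (f₁ p) := fun p => by
    rw [← hinv (f₂ (h' p)), ← hconj, hinv']
  have hm : 0 < (h (X 1)).totalDegree := totalDegree_algHom_X_pos hinv 1
  obtain ⟨a, ha0, ha⟩ := exists_topForm_totalDegree (F := h (X 0))
    (fun h0 => algHom_X_ne_C hinv 0 0 (by rw [h0, C_0]))
  obtain ⟨b, hb0, hb⟩ := exists_topForm_totalDegree (F := h (X 1))
    (fun h0 => algHom_X_ne_C hinv 1 0 (by rw [h0, C_0]))
  generalize (h (X 0)).totalDegree = n at *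
  generalize (h (X 1)).totalDegree = m at *
  have hab : ∀ i, HasTopForm (fun _ => 1) (![n, m] i) (h (X i)) (![a, b] i) := by
    simpa [Fin.forall_fin_two] using ⟨ha, hb⟩
  have hF : ∀ i, HasTopForm (fun _ => 1) d (f₁ (X i))
      (![homogeneousComponent d (f₁ (X 0)), homogeneousComponent d (f₁ (X 1))] i) := by
    simpa [Fin.forall_fin_two] using
      ⟨hasTopForm_totalDegree_le (hf₁ 0), hasTopForm_totalDegree_le (hf₁ 1)⟩
  -- the top form of the first component of `f₂`
  obtain ⟨c, hP⟩ := hasTopForm_C_mul_X_pow hmn (hf₂ 0)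
  have hc : c ≠ 0 := by
    rintro rfl
    rw [C_0, zero_mul] at hP
    have h1 := HasTopForm.map_algHom hab hP
    have h2 := HasTopForm.map_algHom_const hF (by omega) ha
    rw [← hconj] at h1
    rw [map_zero] at h1
    exact aeval_homogeneousComponent_ne_zero hd hnz ha0 ha.isWeightedHomogeneous (h2.unique h1)
  -- the top forms of the inverse
  obtain ⟨K, A, B, hAB, hA, hB⟩ := exists_topForm_pair ![n, m] (F := h' (X 0)) (G := h' (X 1))
    (Or.inl fun h0 => algHom_X_ne_C hinv' 0 0 (by rw [h0, C_0]))
  have hK : 2 ≤ K := two_le_of_hasTopForm hinv (w := ![n, m]) (G := ![A, B])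
    (by simp only [Matrix.cons_val_zero]; omega) (by simpa [Fin.forall_fin_two] using ⟨hA, hB⟩)
  obtain ⟨α, β, φ, hαβ, rfl, rfl⟩ := exists_proportional_topForms hinv ha0 ha hA hB
    (by simp only [Matrix.cons_val_zero]; nlinarith)
  have hφ0 : φ ≠ 0 := by
    rintro rfl
    simp at hAB
  have hABi : ∀ i, HasTopForm ![n, m] K (h' (X i)) (C (![α, β] i) * φ) := by
    simpa [Fin.forall_fin_two] using ⟨hA, hB⟩
  obtain ⟨i, hi⟩ : ∃ i, ![α, β] i ≠ 0 := by
    rcases hαβ with hα | hβ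
    · exact ⟨0, hα⟩
    · exact ⟨1, hβ⟩
  have hφ : IsWeightedHomogeneous ![n, m] φ K := by
    intro e he
    refine (hABi i).isWeightedHomogeneous (d := e) ?_
    rw [coeff_C_mul]
    exact mul_ne_zero hi he
  have hφab : aeval ![a, b] φ = 0 := by
    have h1 := HasTopForm.map_algHom hab (hABi i)
    rw [hinv'] at h1
    have h2 := h1.eq_zero_of_lt (HasTopForm.X _ i) hK
    rw [map_mul, ← algebraMap_eq, AlgHom.commutes, algebraMap_eq, mul_eq_zero] at h2
    exact h2.resolve_left (by simpa using hi)
  obtain ⟨t, ht0, ht⟩ := exists_root_of_aeval_eq_zero hφ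
    (by simp only [Matrix.cons_val_zero]; omega) ha0 hb0 hφab
  have hn : 0 < ![n, m] 0 := by simp only [Matrix.cons_val_zero]; omega
  -- the weight of the second component of `f₂`
  have hQ : weightedTotalDegree ![n, m] (f₂ (X 1)) ≤ d * m := by
    by_contra! hD
    obtain ⟨Q, hQ0, hQ⟩ := HasTopForm.exists_ne_zero ![n, m] (f := f₂ (X 1)) (by
      intro h0
      simp [h0, weightedTotalDegree_zero] at hD)
    generalize weightedTotalDegree ![n, m] (f₂ (X 1)) = D at *
    obtain ⟨K', A', B', hAB', hA', hB'⟩ := exists_topForm_pair ![d * n, D]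
      (F := h' (X 0)) (G := h' (X 1))
      (Or.inl fun h0 => algHom_X_ne_C hinv' 0 0 (by rw [h0, C_0]))
    have hABi' : ∀ i, HasTopForm ![d * n, D] K' (h' (X i)) (![A', B'] i) := by
      simpa [Fin.forall_fin_two] using ⟨hA', hB'⟩
    have hlt : d * K < K' := by
      have hpos := natDegree_aeval_C_X_pos hφ hn hφ0 ht
      obtain ⟨e, he, he1⟩ := exists_coeff_of_coeff_aeval_C_X_ne_zero
        (Polynomial.leadingCoeff_ne_zero.2 (Polynomial.ne_zero_of_natDegree_gt hpos))
      have h1 := (hABi' i).1 e ((hABi i).coeff_ne_zero (by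
        rw [coeff_C_mul]
        exact mul_ne_zero hi he))
      have h2 := hφ he
      rw [weight_fin_two] at h1 h2
      rw [← he1] at hpos
      simp only [Matrix.cons_val_zero, Matrix.cons_val_one] at h1 h2
      nlinarith
    have hPQ : ∀ i, HasTopForm ![n, m] (![d * n, D] i) (f₂ (X i)) (![C c * X 0 ^ d, Q] i) := by
      simpa [Fin.forall_fin_two] using ⟨hP, hQ⟩
    have hzero : ∀ j, aeval ![C c * X 0 ^ d, Q] (![A', B'] j) = 0 := fun j => by
      have h1 := HasTopForm.map_algHom hPQ (hABi' j)
      rw [hconj'] at h1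
      have h2 := HasTopForm.map_algHom_const hABi (by omega) (hF j)
      exact h1.eq_zero_of_lt h2 (by linarith [mul_comm K d])
    obtain ⟨j, hj⟩ : ∃ j, ![A', B'] j ≠ 0 := by
      rcases hAB' with hα | hβ
      · exact ⟨0, hα⟩
      · exact ⟨1, hβ⟩
    set δ : MvPolynomial (Fin 2) k →ₐ[k] Polynomial k :=
      aeval ![Polynomial.C 1, Polynomial.X] with hδ
    have hq : δ Q = Polynomial.C ((δ Q).coeff 0) := by
      have h1 := congrArg δ (hzero j)
      have hδX : δ (X 0) = 1 := by simp [hδ]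
      have hδC : δ (C c) = Polynomial.C c := by simp [hδ]
      rw [map_aeval_pair, map_mul, map_pow, map_zero, hδX, hδC, one_pow, mul_one] at h1
      have h2 : (aeval ![Polynomial.C c, Polynomial.X] (![A', B'] j) : Polynomial k).comp (δ Q)
          = 0 := by
        change Polynomial.aeval (δ Q) _ = _
        rw [map_aeval_pair, Polynomial.aeval_X, Polynomial.aeval_C, Polynomial.algebraMap_eq, h1]
      exact ((Polynomial.comp_eq_zero_iff.1 h2).resolve_left
        ((hABi' j).isWeightedHomogeneous.aeval_C_X_ne_zero
          (Nat.mul_pos (by omega) (by omega)) hc hj)).2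
    have hQ1 : ∀ e, coeff e Q ≠ 0 → e 1 = 0 := fun e he => by
      by_contra hne
      have := hQ.isWeightedHomogeneous.coeff_aeval_C_X hn 1 he
      rw [← hδ, hq, Polynomial.coeff_C, if_neg hne, one_pow, mul_one] at this
      exact he this.symm
    have hQab : aeval ![a, b] Q ≠ 0 := by
      obtain ⟨e, he⟩ := ne_zero_iff.1 hQ0
      have hQmon : Q = monomial e (coeff e Q) := by
        classical
        ext e'
        rw [coeff_monomial]
        split_ifs with hee
        · rw [hee]
        · by_contra he'
          have h1 := hQ.isWeightedHomogeneous he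
          rw [← hQ.isWeightedHomogeneous he', weight_fin_two, weight_fin_two, hQ1 e he,
            hQ1 e' he', zero_mul, add_zero, add_zero] at h1
          apply hee
          ext i
          fin_cases i
          · exact Nat.eq_of_mul_eq_mul_right hn h1
          · exact (hQ1 e he).trans (hQ1 e' he').symm
      rw [hQmon, aeval_monomial, Finsupp.prod_fintype _ _ (fun i => pow_zero _), Fin.prod_univ_two,
        hQ1 e he, pow_zero, mul_one, algebraMap_eq]
      exact mul_ne_zero (by simpa using he) (pow_ne_zero _ ha0)
    have h1 := HasTopForm.map_algHom hab hQ
    rw [← hconj] at h1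
    have h2 := HasTopForm.map_algHom_const hF (by omega) hb
    exact hQab (h1.eq_zero_of_lt h2 hD)
  obtain ⟨Q, hQ⟩ := HasTopForm.exists_of_weightedTotalDegree_le hQ
  have hPQ : ∀ i, HasTopForm ![n, m] (d * ![n, m] i) (f₂ (X i)) (![C c * X 0 ^ d, Q] i) := by
    simpa [Fin.forall_fin_two] using ⟨hP, hQ⟩
  -- comparison of the top forms of `h' ∘ f₂ = f₁ ∘ h'`
  have hcomp : ∀ j, C (![α, β] j) * aeval ![C c * X 0 ^ d, Q] φ =
      C (eval ![α, β] (homogeneousComponent d (f₁ (X j)))) * φ ^ d := fun j => by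
    have h1 := HasTopForm.map_algHom hPQ ((hABi j).mul_weight (show 0 < d by omega))
    have h2 := HasTopForm.map_algHom_const hABi (by omega) (hasTopForm_totalDegree_le (hf₁ j))
    rw [hconj', mul_comm d K] at h1
    have h3 := h1.unique h2
    have hFj := (hasTopForm_totalDegree_le (hf₁ j)).isWeightedHomogeneous
    have h4 := hFj.aeval_smul φ (fun i => C (![α, β] i))
    rw [map_mul, ← algebraMap_eq, AlgHom.commutes] at h3
    rw [← algebraMap_eq, h3]
    simp only [pow_one, mul_comm φ] at h4
    rw [algebraMap_eq, h4, mul_comm]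
    congr 1
    rw [← algebraMap_eq, ← aeval_eq_eval]
    exact aeval_algebraMap_apply _ _ _
  obtain ⟨j, hj⟩ : ∃ j, eval ![α, β] (homogeneousComponent d (f₁ (X j))) ≠ 0 := by
    by_contra! hall
    exact hnz ![α, β] (fun h0 => hi (congrFun h0 i)) ⟨hall 0, hall 1⟩
  have hj' : ![α, β] j ≠ 0 := by
    intro h0
    have := hcomp j
    rw [h0, C_0, zero_mul] at this
    exact mul_ne_zero (by simpa using hj) (pow_ne_zero d hφ0) this.symm
  refine aeval_pow_ne_C_mul_pow hφ hn hφ0 ht hm hmn ht0 hd hc (div_ne_zero hj hj') Q ?_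
  apply mul_left_cancel₀ (show C (![α, β] j) ≠ 0 by simpa using hj')
  rw [hcomp, ← mul_assoc, ← map_mul, mul_div_cancel₀ _ hj']

variable (hf₂ : ∀ i, (f₂ (X i)).totalDegree ≤ d)
include hf₂

/-- The components of a conjugating automorphism have the same degree, even after a linear change of
coordinates on the target. -/
lemma not_totalDegree_lt_of_conj_linear [IsAlgClosed k] [CharZero k]
    {e e' : MvPolynomial (Fin 2) k →ₐ[k] MvPolynomial (Fin 2) k}
    (hee' : ∀ p, e (e' p) = p) (he'e : ∀ p, e' (e p) = p)
    (he : ∀ i, (e (X i)).totalDegree ≤ 1) (he' : ∀ i, (e' (X i)).totalDegree ≤ 1) :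
    ¬ (h (e (X 1))).totalDegree < (h (e (X 0))).totalDegree := by
  refine not_totalDegree_lt_of_conj (f₁ := f₁) (f₂ := e'.comp (f₂.comp e)) (h := h.comp e)
    (h' := e'.comp h') (fun p => ?_) (fun p => ?_) (fun p => ?_) hd hf₁ hnz fun i => ?_
  · simp [hinv, he'e]
  · simp [hinv', hee']
  · simp [hconj, hee']
  · refine (totalDegree_algHom_le he' _).trans ?_
    have := HasTopForm.map_algHom_const (fun i => hasTopForm_totalDegree_le (hf₂ i)) (by omega)
      (hasTopForm_totalDegree_le (he i))
    simpa using this.totalDegree_le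

theorem totalDegree_eq_one_of_conj [IsAlgClosed k] [CharZero k] :
    max (h (X 0)).totalDegree (h (X 1)).totalDegree = 1 := by
  have hswap : (h (X 1)).totalDegree = (h (X 0)).totalDegree := by
    apply le_antisymm
    · set e : MvPolynomial (Fin 2) k →ₐ[k] MvPolynomial (Fin 2) k := aeval ![X 1, X 0] with he
      have hee : ∀ p, e (e p) = p := fun p => by
        refine congrArg (fun η : _ →ₐ[k] _ => η p) (?_ : e.comp e = AlgHom.id k _)
        ext i : 1
        fin_cases i <;> simp [he]
      have hdeg : ∀ i, (e (X i)).totalDegree ≤ 1 := by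
        simp [he, Fin.forall_fin_two, totalDegree_X]
      have := not_totalDegree_lt_of_conj_linear hinv hinv' hconj hd hf₁ hnz hf₂ hee hee hdeg hdeg
      simpa [he] using this
    · exact not_lt.1 (not_totalDegree_lt_of_conj hinv hinv' hconj hd hf₁ hnz hf₂)
  rw [hswap, max_self]
  by_contra hne
  have hpos := totalDegree_algHom_X_pos hinv 0
  have hfst := exists_topForm_totalDegree (F := h (X 0))
    (fun h0 => algHom_X_ne_C hinv 0 0 (by rw [h0, C_0]))
  have hsnd := exists_topForm_totalDegree (F := h (X 1))
    (fun h0 => algHom_X_ne_C hinv 1 0 (by rw [h0, C_0]))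
  rw [hswap] at hsnd
  obtain ⟨a, ha0, ha⟩ := hfst
  obtain ⟨b, -, hb⟩ := hsnd
  obtain ⟨a', ha0', ha'⟩ := exists_topForm_totalDegree (F := h' (X 0))
    (fun h0 => algHom_X_ne_C hinv' 0 0 (by rw [h0, C_0]))
  have hpos' := totalDegree_algHom_X_pos hinv' 0
  obtain ⟨α, β, φ, -, rfl, rfl⟩ := exists_proportional_topForms hinv' ha0' ha' ha hb
    (by
      have h2 : 2 ≤ (h (X 0)).totalDegree := by omega
      nlinarith)
  have hα : α ≠ 0 := by
    rintro rfl
    simp at ha0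
  set e : k → MvPolynomial (Fin 2) k →ₐ[k] MvPolynomial (Fin 2) k :=
    fun r => aeval ![X 0, X 1 + C r * X 0] with he
  have hee : ∀ r p, e r (e (-r) p) = p := fun r p => by
    refine congrArg (fun η : _ →ₐ[k] _ => η p) (?_ : (e r).comp (e (-r)) = AlgHom.id k _)
    ext i : 1
    fin_cases i <;> simp [he, algHom_C]
  have hdeg : ∀ r i, (e r (X i)).totalDegree ≤ 1 := by
    intro r i
    fin_cases i
    · simp [he, totalDegree_X]
    · simp only [he, Fin.mk_one, aeval_X, Matrix.cons_val_one]
      refine (totalDegree_add _ _).trans (max_le (totalDegree_X _).le ?_)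
      refine (totalDegree_mul _ _).trans ?_
      rw [totalDegree_C, totalDegree_X]
  refine not_totalDegree_lt_of_conj_linear hinv hinv' hconj hd hf₁ hnz hf₂ (e := e (-(β / α)))
    (e' := e (β / α)) (fun p => by simpa using hee (-(β / α)) p) (hee _) (hdeg _) (hdeg _) ?_
  simp only [he, aeval_X, Matrix.cons_val_zero, Matrix.cons_val_one, map_add, map_mul, algHom_C,
    algebraMap_eq]
  refine HasTopForm.totalDegree_lt hpos ?_
  convert hb.add (ha.C_mul (-(β / α))) using 1
  rw [← mul_assoc, ← C_mul, ← add_mul, ← C_add, neg_mul, div_mul_cancel₀ _ hα, add_neg_cancel,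
    C_0, zero_mul]

end Conjugation

end Automorphism

end MvPolynomial

/-- If `f₁`, `f₂` are polynomial endomorphisms of `𝔸²` of degree `d ≥ 2` that extend to
endomorphisms of `ℙ²` of degree `d`, and a polynomial automorphism `h` of `𝔸²` conjugates
`f₁` to `f₂`, then `h` is affine, i.e. `deg h = 1`. -/
theorem conjugating_polynomial_automorphism_is_affine
    (k : Type*) [Field k] [IsAlgClosed k] [CharZero k]
    (d : ℕ) (hd : 2 ≤ d)
    -- `f₁ = (P₁, Q₁)`, `f₂ = (P₂, Q₂)`, `h = (H₁, H₂)` with inverse `(H₁', H₂')`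
    (P₁ Q₁ P₂ Q₂ H₁ H₂ H₁' H₂' : MvPolynomial (Fin 2) k)
    (hdeg₁ : max P₁.totalDegree Q₁.totalDegree = d)
    (hdeg₂ : max P₂.totalDegree Q₂.totalDegree = d)
    -- the degree-`d` homogeneous parts have no common zero outside the origin,
    -- i.e. `f₁`, `f₂` extend to endomorphisms of `ℙ²` of degree `d`
    (hnz₁ : ∀ v : Fin 2 → k, v ≠ 0 →
      ¬(eval v (homogeneousComponent d P₁) = 0 ∧ eval v (homogeneousComponent d Q₁) = 0))
    (hnz₂ : ∀ v : Fin 2 → k, v ≠ 0 →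
      ¬(eval v (homogeneousComponent d P₂) = 0 ∧ eval v (homogeneousComponent d Q₂) = 0))
    -- `h` is a polynomial automorphism: `(H₁', H₂')` is a two-sided polynomial inverse
    (hinv₁ : aeval ![H₁, H₂] H₁' = X 0) (hinv₂ : aeval ![H₁, H₂] H₂' = X 1)
    (hinv₃ : aeval ![H₁', H₂'] H₁ = X 0) (hinv₄ : aeval ![H₁', H₂'] H₂ = X 1)
    -- `h ∘ f₁ = f₂ ∘ h`
    (hconj₁ : aeval ![P₁, Q₁] H₁ = aeval ![H₁, H₂] P₂)
    (hconj₂ : aeval ![P₁, Q₁] H₂ = aeval ![H₁, H₂] Q₂) :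
    max H₁.totalDegree H₂.totalDegree = 1 := by
  have hcomp : ∀ {f g f' g' : MvPolynomial (Fin 2) k →ₐ[k] MvPolynomial (Fin 2) k},
      f (g (X 0)) = f' (g' (X 0)) → f (g (X 1)) = f' (g' (X 1)) →
      ∀ p, f (g p) = f' (g' p) := by
    intro f g f' g' h0 h1 p
    refine congrArg (fun η : _ →ₐ[k] _ => η p) (?_ : f.comp g = f'.comp g')
    ext i : 1
    fin_cases i
    · exact h0
    · exact h1
  have := totalDegree_eq_one_of_conj (f₁ := aeval ![P₁, Q₁]) (f₂ := aeval ![P₂, Q₂])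
    (h := aeval ![H₁, H₂]) (h' := aeval ![H₁', H₂'])
    (hcomp (f' := AlgHom.id k _) (g' := AlgHom.id k _) (by simpa using hinv₃)
      (by simpa using hinv₄))
    (hcomp (f' := AlgHom.id k _) (g' := AlgHom.id k _) (by simpa using hinv₁)
      (by simpa using hinv₂))
    (hcomp (by simpa using hconj₁) (by simpa using hconj₂)) hd
    (by simpa [Fin.forall_fin_two] using hdeg₁.le) (by simpa using hnz₁)
    (by simpa [Fin.forall_fin_two] using hdeg₂.le)
  simpa using this
end

section
/- Let k be an algebraically closed field of characteristic 0, and let P, Q ∈ k[x,y] satisfy k[P,Q] = k[x,y], so that every nonzero F ∈ k[x,y] has a unique expression F = Σ_{i,j≥0} a_{ij} P^i Q^j with a_{ij} ∈ k. Let s, t be real numbers and suppose that for every nonzero F ∈ k[x,y] one has deg F = max{ s·i + t·j : a_{ij} ≠ 0 } (i.e. the valuation −deg is the monomial valuation for (P,Q) of weight (s,t)). Then s = t = 1 and deg P = deg Q = 1. -/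
open MvPolynomial

theorem MvPolynomial.eq_C_add_C_mul_X_of_support {σ R : Type*} [CommSemiring R] (i : σ)
    (G : MvPolynomial σ R) (h : ∀ m ∈ G.support, m = 0 ∨ m = Finsupp.single i 1) :
    G = C (coeff 0 G) + C (coeff (Finsupp.single i 1) G) * X i := by
  classical
  have hne : (Finsupp.single i 1 : σ →₀ ℕ) ≠ 0 := by simp
  ext m
  by_cases hm : m ∈ G.support
  · rcases h m hm with rfl | rfl
    · simp [coeff_X, hne]
    · simp [coeff_C, hne.symm]
  · have h0 : coeff m G = 0 := notMem_support_iff.mp hm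
    rw [h0, coeff_add, coeff_C_mul, coeff_C, coeff_X]
    split_ifs with h1 h2 h2
    · exact absurd (h1.trans h2.symm) hne.symm
    · simp_all
    · simp_all
    · simp

theorem MvPolynomial.X_zero_X_one_not_affine_in_one {k : Type*} [Field k]
    (R : MvPolynomial (Fin 2) k) (a b a' b' : k) (h0 : X 0 = C a + C b * R)
    (h1 : X 1 = C a' + C b' * R) : False := by
  have e (i : Fin 2) : (0 : Fin 2 →₀ ℕ) ≠ Finsupp.single i 1 := by
    simp [eq_comm]
  have hs : (Finsupp.single 1 1 : Fin 2 →₀ ℕ) ≠ Finsupp.single 0 1 := by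
    simp [Finsupp.single_left_inj]
  have c00 := congrArg (coeff (Finsupp.single 0 1)) h0
  have c10 := congrArg (coeff (Finsupp.single 0 1)) h1
  have c11 := congrArg (coeff (Finsupp.single 1 1)) h1
  simp only [coeff_add, coeff_C_mul, coeff_C, coeff_X, e, hs, if_true, if_false, zero_add]
    at c00 c10 c11
  rcases mul_eq_zero.mp c10.symm with h | h
  · simp [h] at c11
  · simp [h] at c00

theorem MvPolynomial.totalDegree_aeval_X_pos {σ τ k : Type*} [Field k]
    (f : MvPolynomial σ k →ₐ[k] MvPolynomial τ k) (hf : Function.Injective f) (i : σ) :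
    0 < (f (X i)).totalDegree := by
  rw [Nat.pos_iff_ne_zero]
  intro h
  have h1 := totalDegree_eq_zero_iff_eq_C.mp h
  have h2 : f (X i) = f (C (coeff 0 (f (X i)))) := by
    rw [← algebraMap_eq, f.commutes, algebraMap_eq]
    exact h1
  have h3 := congrArg totalDegree (hf h2)
  simp at h3

/-- If `(P,Q)` is a polynomial basis of `k[x,y]` (i.e. `G ↦ G(P,Q)` is bijective,
encoding existence and uniqueness of the decompositions `F = Σ a_{ij} P^i Q^j`), and the
valuation `-deg` is the monomial valuation for `(P,Q)` of weight `(s,t)`, i.e.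
`deg F = max{ s·i + t·j : a_{ij} ≠ 0 }` for every nonzero `F`, then `s = t = 1` and
`P`, `Q` have degree one. -/
theorem deg_monomial_valuation_implies_linear_basis
    (k : Type*) [Field k] [IsAlgClosed k] [CharZero k]
    (P Q : MvPolynomial (Fin 2) k)
    -- `k[P,Q] = k[x,y]` with unique decompositions
    (hbasis : Function.Bijective
      (aeval ![P, Q] : MvPolynomial (Fin 2) k →ₐ[k] MvPolynomial (Fin 2) k))
    (s t : ℝ)
    -- `deg F = max{ s·i + t·j : a_{ij} ≠ 0 }` for every nonzero `F = G(P,Q)`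
    (hdeg : ∀ (G : MvPolynomial (Fin 2) k) (hG : G.support.Nonempty),
      ((aeval ![P, Q] G).totalDegree : ℝ) =
        G.support.sup' hG fun m => s * (m 0 : ℝ) + t * (m 1 : ℝ)) :
    s = 1 ∧ t = 1 ∧ P.totalDegree = 1 ∧ Q.totalDegree = 1 := by
  have hdegX (i : Fin 2) : ((![P, Q] i).totalDegree : ℝ) = ![s, t] i := by
    have h := hdeg (X i) (by simp [support_X])
    simp only [aeval_X, support_X, Finset.sup'_singleton] at h
    rw [h]
    fin_cases i <;> simp
  have hpos (i : Fin 2) : 0 < (![P, Q] i).totalDegree := by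
    simpa using totalDegree_aeval_X_pos _ hbasis.injective i
  have hs : (P.totalDegree : ℝ) = s := hdegX 0
  have ht : (Q.totalDegree : ℝ) = t := hdegX 1
  have hP : 0 < P.totalDegree := hpos 0
  have hQ : 0 < Q.totalDegree := hpos 1
  have hrep (j : Fin 2) : ∃ G : MvPolynomial (Fin 2) k, aeval ![P, Q] G = X j ∧
      ∀ m ∈ G.support, P.totalDegree * m 0 + Q.totalDegree * m 1 ≤ 1 := by
    obtain ⟨G, hG⟩ := hbasis.surjective (X j)
    refine ⟨G, hG, fun m hm => ?_⟩
    have h := hdeg G ⟨m, hm⟩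
    rw [hG, totalDegree_X] at h
    have h' := Finset.le_sup' (fun m : Fin 2 →₀ ℕ => s * (m 0 : ℝ) + t * (m 1 : ℝ)) hm
    rw [← h, ← hs, ← ht] at h'
    exact_mod_cast h'
  obtain ⟨G, hG, hGs⟩ := hrep 0
  obtain ⟨H, hH, hHs⟩ := hrep 1
  have not_single (i : Fin 2) (h : ∀ m : Fin 2 →₀ ℕ,
      P.totalDegree * m 0 + Q.totalDegree * m 1 ≤ 1 → m = 0 ∨ m = Finsupp.single i 1) :
      False := by
    have hG' := eq_C_add_C_mul_X_of_support i G fun m hm => h m (hGs m hm)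
    have hH' := eq_C_add_C_mul_X_of_support i H fun m hm => h m (hHs m hm)
    rw [hG'] at hG
    rw [hH'] at hH
    simp only [map_add, map_mul, aeval_X, aeval_C, algebraMap_eq] at hG hH
    exact X_zero_X_one_not_affine_in_one _ _ _ _ _ hG.symm hH.symm
  have hP1 : P.totalDegree = 1 := by
    by_contra hne
    refine not_single 1 fun m hm => ?_
    have h0 : m 0 = 0 := by
      by_contra h
      have := Nat.mul_le_mul (show 2 ≤ P.totalDegree by omega) (Nat.one_le_iff_ne_zero.mpr h)
      omega
    have h1 : m 1 ≤ 1 := by nlinarith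
    rcases Nat.le_one_iff_eq_zero_or_eq_one.mp h1 with h | h
    · left; ext i; fin_cases i <;> simp [h0, h]
    · right; ext i; fin_cases i <;> simp [h0, h]
  have hQ1 : Q.totalDegree = 1 := by
    by_contra hne
    refine not_single 0 fun m hm => ?_
    have h1 : m 1 = 0 := by
      by_contra h
      have := Nat.mul_le_mul (show 2 ≤ Q.totalDegree by omega) (Nat.one_le_iff_ne_zero.mpr h)
      omega
    have h0 : m 0 ≤ 1 := by nlinarith
    rcases Nat.le_one_iff_eq_zero_or_eq_one.mp h0 with h | h
    · left; ext i; fin_cases i <;> simp [h1, h]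
    · right; ext i; fin_cases i <;> simp [h1, h]
  refine ⟨?_, ?_, hP1, hQ1⟩
  · rw [← hs, hP1, Nat.cast_one]
  · rw [← ht, hQ1, Nat.cast_one]
end

section
/- Let k be an algebraically closed field of characteristic 0 and d ≥ 2. For N ∈ GL₂(ℤ) let m_N be the monomial self-map of the torus (k^×)² given by m_N(x,y) = (x^{N₁₁} y^{N₁₂}, x^{N₂₁} y^{N₂₂}), and let g_d(x,y) = (x^d, y^d). Let A₁, A₂, M ∈ GL₂(ℤ), let u, v ∈ k^×, and set h(x,y) = (u·x^{M₁₁} y^{M₁₂}, v·x^{M₂₁} y^{M₂₂}), f₁ = m_{A₁} ∘ g_d, f₂ = m_{A₂} ∘ g_d. If h ∘ f₁ = f₂ ∘ h on (k^×)², then M A₁ M^{−1} = A₂ in GL₂(ℤ), and u and v are roots of unity. -/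
/-- Cramer's rule for a pair of multiplicative relations between two elements. -/
theorem zpow_det_eq_one_of_relations {G : Type*} [CommGroup G] {u v : G} {p q r s : ℤ}
    (h₁ : u ^ p * v ^ q = 1) (h₂ : u ^ r * v ^ s = 1) :
    u ^ (p * s - q * r) = 1 ∧ v ^ (p * s - q * r) = 1 := by
  constructor
  · calc u ^ (p * s - q * r) = (u ^ p * v ^ q) ^ s * ((u ^ r * v ^ s) ^ q)⁻¹ := by
          simp only [mul_zpow, ← zpow_mul, mul_inv, ← zpow_neg]
          rw [mul_mul_mul_comm, ← zpow_add, ← zpow_add]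
          ring_nf
          simp
      _ = 1 := by simp [h₁, h₂]
  · calc v ^ (p * s - q * r) = (u ^ r * v ^ s) ^ p * ((u ^ p * v ^ q) ^ r)⁻¹ := by
          simp only [mul_zpow, ← zpow_mul, mul_inv, ← zpow_neg]
          rw [mul_mul_mul_comm, ← zpow_add, ← zpow_add]
          ring_nf
          simp
      _ = 1 := by simp [h₁, h₂]

theorem exists_pos_pow_eq_one_of_zpow {G : Type*} [Group G] {u : G} {n : ℤ}
    (hn : n ≠ 0) (h : u ^ n = 1) : ∃ m : ℕ, 0 < m ∧ u ^ m = 1 :=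
  ⟨n.natAbs, Int.natAbs_pos.mpr hn, pow_natAbs_eq_one.mpr h⟩

/-- An affine monomial identity along a one-parameter subgroup generated by an element `t` of
infinite order determines the exponents, once the constant terms agree. -/
theorem exponent_eq_of_monomial_identity {G : Type*} [CommGroup G] {t u v w : G}
    (ht : Function.Injective fun n : ℤ => t ^ n) {d : ℕ} (hd : d ≠ 0)
    {a b c e p q m n : ℤ} (hw : w = (u ^ d) ^ a * (v ^ d) ^ b)
    (h : w * (((t ^ d) ^ c) ^ p * ((t ^ d) ^ e) ^ q) =
      ((u * t ^ m) ^ d) ^ a * ((v * t ^ n) ^ d) ^ b) :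
    p * c + q * e = a * m + b * n := by
  rw [mul_pow, mul_pow, mul_zpow, mul_zpow, mul_mul_mul_comm, ← hw, mul_right_inj] at h
  simp only [← zpow_natCast, ← zpow_mul, ← zpow_add] at h
  have hd' : (d : ℤ) ≠ 0 := by exact_mod_cast hd
  have hexp := ht h
  exact mul_left_cancel₀ hd' (by linear_combination hexp)

/-- `det (d A - 1)` is congruent to `1` modulo `d`, hence nonzero when `d ≥ 2`. -/
theorem det_smul_sub_one_ne_zero {d : ℤ} (hd : 2 ≤ d) (a b c e : ℤ) :
    (d * a - 1) * (d * e - 1) - d * b * (d * c) ≠ 0 := by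
  intro h
  have h1 : d ∣ 1 := ⟨a + e - d * a * e + d * b * c, by linear_combination h⟩
  have := Int.le_of_dvd one_pos h1
  omega

theorem two_zpow_units_injective (k : Type*) [Field k] [CharZero k] :
    Function.Injective fun n : ℤ => (Units.mk0 (2 : k) two_ne_zero) ^ n := by
  refine injective_zpow_iff_not_isOfFinOrder.mpr fun h => ?_
  obtain ⟨n, hn, h⟩ := isOfFinOrder_iff_pow_eq_one.mp h
  have h2 : ((2 ^ n : ℕ) : k) = (1 : ℕ) := by simpa [Units.ext_iff] using h
  exact absurd (Nat.cast_injective h2) (Nat.one_lt_two_pow hn.ne').ne'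

open Matrix

/-- Case (P3): if `h = (diagonal map (u,v)) ∘ m_M` is an automorphism of the torus
`(k^×)²` conjugating `f₁ = m_{A₁} ∘ g_d` to `f₂ = m_{A₂} ∘ g_d` (where `m_N` is the
monomial map attached to `N ∈ GL₂(ℤ)` and `g_d(x,y) = (x^d, y^d)`), then `M` conjugates
`A₁` to `A₂` in `GL₂(ℤ)` and `u`, `v` are roots of unity. -/
theorem case_P3_monomial_conjugacy
    (k : Type*) [Field k] [IsAlgClosed k] [CharZero k]
    (d : ℕ) (hd : 2 ≤ d)
    (A₁ A₂ M : GL (Fin 2) ℤ) (u v : kˣ)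
    -- `h ∘ f₁ = f₂ ∘ h` on `(k^×)²`, where
    -- `h(x,y) = (u·x^{M₁₁}y^{M₁₂}, v·x^{M₂₁}y^{M₂₂})`, `fᵢ = m_{Aᵢ} ∘ g_d`
    (hconj : ∀ x y : kˣ,
      (fun p : kˣ × kˣ =>
          (u * (p.1 ^ ((M : Matrix (Fin 2) (Fin 2) ℤ) 0 0) *
                p.2 ^ ((M : Matrix (Fin 2) (Fin 2) ℤ) 0 1)),
           v * (p.1 ^ ((M : Matrix (Fin 2) (Fin 2) ℤ) 1 0) *
                p.2 ^ ((M : Matrix (Fin 2) (Fin 2) ℤ) 1 1))))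
        ((x ^ d) ^ ((A₁ : Matrix (Fin 2) (Fin 2) ℤ) 0 0) *
           (y ^ d) ^ ((A₁ : Matrix (Fin 2) (Fin 2) ℤ) 0 1),
         (x ^ d) ^ ((A₁ : Matrix (Fin 2) (Fin 2) ℤ) 1 0) *
           (y ^ d) ^ ((A₁ : Matrix (Fin 2) (Fin 2) ℤ) 1 1)) =
      (fun p : kˣ × kˣ =>
          ((p.1 ^ d) ^ ((A₂ : Matrix (Fin 2) (Fin 2) ℤ) 0 0) *
             (p.2 ^ d) ^ ((A₂ : Matrix (Fin 2) (Fin 2) ℤ) 0 1),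
           (p.1 ^ d) ^ ((A₂ : Matrix (Fin 2) (Fin 2) ℤ) 1 0) *
             (p.2 ^ d) ^ ((A₂ : Matrix (Fin 2) (Fin 2) ℤ) 1 1)))
        (u * (x ^ ((M : Matrix (Fin 2) (Fin 2) ℤ) 0 0) *
              y ^ ((M : Matrix (Fin 2) (Fin 2) ℤ) 0 1)),
         v * (x ^ ((M : Matrix (Fin 2) (Fin 2) ℤ) 1 0) *
              y ^ ((M : Matrix (Fin 2) (Fin 2) ℤ) 1 1)))) :
    M * A₁ * M⁻¹ = A₂ ∧
      (∃ n : ℕ, 0 < n ∧ u ^ n = 1) ∧ (∃ n : ℕ, 0 < n ∧ v ^ n = 1) := by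
  have hd0 : d ≠ 0 := by omega
  have ht := two_zpow_units_injective k
  set t : kˣ := Units.mk0 (2 : k) two_ne_zero
  have h1 := hconj 1 1
  have hx := hconj t 1
  have hy := hconj 1 t
  simp only [one_pow, _root_.one_zpow, mul_one, one_mul, Prod.mk.injEq] at h1 hx hy
  obtain ⟨hu, hv⟩ := h1
  have e00 := exponent_eq_of_monomial_identity ht hd0 hu hx.1
  have e10 := exponent_eq_of_monomial_identity ht hd0 hv hx.2
  have e01 := exponent_eq_of_monomial_identity ht hd0 hu hy.1
  have e11 := exponent_eq_of_monomial_identity ht hd0 hv hy.2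
  refine ⟨?_, ?_⟩
  · rw [mul_inv_eq_iff_eq_mul]
    ext i j
    fin_cases i <;> fin_cases j <;>
      simp [Matrix.mul_apply, Fin.sum_univ_two] <;> assumption
  · simp only [← _root_.zpow_natCast, ← _root_.zpow_mul] at hu hv
    have ru : u ^ ((d : ℤ) * A₂ 0 0 - 1) * v ^ ((d : ℤ) * A₂ 0 1) = 1 := by
      rw [_root_.zpow_sub_one, mul_right_comm, ← hu, mul_inv_cancel]
    have rv : u ^ ((d : ℤ) * A₂ 1 0) * v ^ ((d : ℤ) * A₂ 1 1 - 1) = 1 := by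
      rw [_root_.zpow_sub_one, ← mul_assoc, ← hv, mul_inv_cancel]
    obtain ⟨hu', hv'⟩ := zpow_det_eq_one_of_relations ru rv
    have hdet := det_smul_sub_one_ne_zero (d := d) (by exact_mod_cast hd)
      (A₂ 0 0) (A₂ 0 1) (A₂ 1 0) (A₂ 1 1)
    exact ⟨exists_pos_pow_eq_one_of_zpow hdet hu', exists_pos_pow_eq_one_of_zpow hdet hv'⟩
end

section
/- Let p be a prime, s ≥ 2 an integer, q = p^s, and k an algebraic closure of F_p (so F_q ⊂ k). Let G(x,y) = x y^p + (x−1) y and let P ∈ F_q[x] satisfy 2 ≤ deg P ≤ q/p − 1. Define the polynomial self-maps of k²: f₁(x,y) = (x^q, y^q + G(x,y)), f₂(x,y) = (x^q, y^q + G(x, y+P(x))), and g(x,y) = (x, y − P(x)). Then g ∘ f₁ = f₂ ∘ g (so the polynomial automorphism g of A²_k conjugates f₁ to f₂), and moreover deg G < deg G(x, y+P(x)) < q, so that both f₁ and f₂ extend to endomorphisms of P²_k of degree q. -/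
open MvPolynomial Polynomial

/-- The polynomial `G(x,y) = x y^p + (x-1) y` of Section 7. -/
noncomputable def sectionSevenG (p : ℕ) [Fact p.Prime] :
    MvPolynomial (Fin 2) (AlgebraicClosure (ZMod p)) :=
  X 0 * X 1 ^ p + (X 0 - 1) * X 1

/-- The shifted polynomial `G(x, y + P(x))`. -/
noncomputable def sectionSevenGs (p : ℕ) [Fact p.Prime]
    (P : Polynomial (AlgebraicClosure (ZMod p))) :
    MvPolynomial (Fin 2) (AlgebraicClosure (ZMod p)) :=
  aeval ![X 0, X 1 + Polynomial.aeval (X 0) P] (sectionSevenG p)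

/-- Frobenius fixes a polynomial whose coefficients it fixes. -/
theorem Polynomial.eval_pow_expChar_pow {R : Type*} [CommRing R] (p s : ℕ) [ExpChar R p]
    (P : Polynomial R) (hP : ∀ i, P.coeff i ^ p ^ s = P.coeff i) (x : R) :
    P.eval x ^ p ^ s = P.eval (x ^ p ^ s) := by
  rw [Polynomial.eval_eq_sum_range, Polynomial.eval_eq_sum_range, sum_pow_char_pow]
  refine Finset.sum_congr rfl fun i _ => ?_
  rw [mul_pow, hP, pow_right_comm]

theorem MvPolynomial.totalDegree_aeval_X_le {R σ : Type*} [CommSemiring R] (i : σ)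
    (P : Polynomial R) :
    (Polynomial.aeval (X i : MvPolynomial σ R) P).totalDegree ≤ P.natDegree := by
  rw [Polynomial.aeval_eq_sum_range]
  refine MvPolynomial.totalDegree_finsetSum_le fun j hj => ?_
  refine (MvPolynomial.totalDegree_smul_le _ _).trans ?_
  refine (MvPolynomial.totalDegree_pow _ _).trans ?_
  have h1 : (X i : MvPolynomial σ R).totalDegree ≤ 1 := by
    rcases subsingleton_or_nontrivial R with h | h
    · simp [Subsingleton.elim (X i : MvPolynomial σ R) 0]
    · simp
  have h2 := Finset.mem_range_succ_iff.mp hj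
  nlinarith

theorem MvPolynomial.totalDegree_mul_le_of_le {R σ : Type*} [CommSemiring R]
    {f g : MvPolynomial σ R} {m n : ℕ} (hf : f.totalDegree ≤ m) (hg : g.totalDegree ≤ n) :
    (f * g).totalDegree ≤ m + n :=
  (MvPolynomial.totalDegree_mul f g).trans (add_le_add hf hg)

theorem MvPolynomial.totalDegree_add_le_of_le {R σ : Type*} [CommSemiring R]
    {f g : MvPolynomial σ R} {n : ℕ} (hf : f.totalDegree ≤ n) (hg : g.totalDegree ≤ n) :
    (f + g).totalDegree ≤ n :=
  (MvPolynomial.totalDegree_add f g).trans (max_le hf hg)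

theorem MvPolynomial.max_totalDegree_X_pow_add {R σ : Type*} [CommSemiring R] [Nontrivial R]
    (i j : σ) {q : ℕ} {H : MvPolynomial σ R} (hH : H.totalDegree < q) :
    max (X i ^ q : MvPolynomial σ R).totalDegree (X j ^ q + H).totalDegree = q := by
  rw [MvPolynomial.totalDegree_X_pow]
  exact max_eq_left (totalDegree_add_le_of_le (MvPolynomial.totalDegree_X_pow j q).le hH.le)

theorem MvPolynomial.homogeneousComponent_X_pow_add {R σ : Type*} [CommSemiring R]
    (i : σ) {q : ℕ} {H : MvPolynomial σ R} (hH : H.totalDegree < q) :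
    homogeneousComponent q (X i ^ q + H) = X i ^ q := by
  rw [map_add, homogeneousComponent_eq_zero q H hH, add_zero,
    homogeneousComponent_of_mem (isHomogeneous_X_pow i q), if_pos rfl]

/-- The map `(x, y) ↦ (x ^ q, y ^ q + H)` with `deg H < q` has no indeterminacy at infinity. -/
theorem MvPolynomial.leading_forms_no_common_zero {R : Type*} [CommRing R] [IsDomain R]
    {q : ℕ} {H : MvPolynomial (Fin 2) R} (hH : H.totalDegree < q) (v : Fin 2 → R) (hv : v ≠ 0) :
    ¬(eval v (homogeneousComponent q (X 0 ^ q)) = 0 ∧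
      eval v (homogeneousComponent q (X 1 ^ q + H)) = 0) := by
  rintro ⟨h0, h1⟩
  rw [homogeneousComponent_of_mem (isHomogeneous_X_pow 0 q), if_pos rfl] at h0
  rw [homogeneousComponent_X_pow_add 1 hH] at h1
  simp only [map_pow, eval_X] at h0 h1
  apply hv
  ext i
  fin_cases i
  · exact eq_zero_of_pow_eq_zero h0
  · exact eq_zero_of_pow_eq_zero h1

theorem sectionSevenGs_eq (p : ℕ) [Fact p.Prime]
    (P : Polynomial (AlgebraicClosure (ZMod p))) :
    sectionSevenGs p P = X 0 * (X 1 + Polynomial.aeval (X 0) P) ^ p +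
      (X 0 - 1) * (X 1 + Polynomial.aeval (X 0) P) := by
  simp [sectionSevenGs, sectionSevenG]

theorem eval_sectionSevenGs (p : ℕ) [Fact p.Prime]
    (P : Polynomial (AlgebraicClosure (ZMod p))) (x y : AlgebraicClosure (ZMod p)) :
    eval ![x, y] (sectionSevenGs p P) = eval ![x, y + P.eval x] (sectionSevenG p) := by
  have h : eval ![x, y] (Polynomial.aeval (X 0) P) = P.eval x := by
    rw [Polynomial.aeval_eq_sum_range, Polynomial.eval_eq_sum_range]
    simp [MvPolynomial.smul_eval]
  simp [sectionSevenGs_eq, sectionSevenG, h]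

theorem totalDegree_X_sub_one_le (p : ℕ) [Fact p.Prime] :
    (X 0 - 1 : MvPolynomial (Fin 2) (AlgebraicClosure (ZMod p))).totalDegree ≤ 1 :=
  (MvPolynomial.totalDegree_sub _ _).trans (by simp)

theorem totalDegree_sectionSevenG_le (p : ℕ) [Fact p.Prime] :
    (sectionSevenG p).totalDegree ≤ p + 1 := by
  have hp := (Fact.out : p.Prime).two_le
  refine totalDegree_add_le_of_le ?_ ?_
  · rw [add_comm p]
    exact totalDegree_mul_le_of_le (MvPolynomial.totalDegree_X _).le
      (MvPolynomial.totalDegree_X_pow _ _).le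
  · exact (totalDegree_mul_le_of_le (totalDegree_X_sub_one_le p)
      (MvPolynomial.totalDegree_X _).le).trans (by omega)

theorem totalDegree_sectionSevenGs (p : ℕ) [Fact p.Prime]
    (P : Polynomial (AlgebraicClosure (ZMod p))) (hP : 1 ≤ P.natDegree) :
    (sectionSevenGs p P).totalDegree = p * P.natDegree + 1 := by
  have hp := (Fact.out : p.Prime).two_le
  have hpd : P.natDegree + 1 < p * P.natDegree + 1 := by nlinarith
  apply le_antisymm
  · rw [sectionSevenGs_eq]
    have h : (X 1 + Polynomial.aeval (X 0) P :
        MvPolynomial (Fin 2) (AlgebraicClosure (ZMod p))).totalDegree ≤ P.natDegree :=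
      totalDegree_add_le_of_le ((MvPolynomial.totalDegree_X _).le.trans hP)
        (totalDegree_aeval_X_le 0 P)
    refine totalDegree_add_le_of_le ?_ ?_
    · rw [add_comm (p * _)]
      exact totalDegree_mul_le_of_le (MvPolynomial.totalDegree_X _).le
        ((MvPolynomial.totalDegree_pow _ _).trans (Nat.mul_le_mul_left p h))
    · exact (totalDegree_mul_le_of_le (totalDegree_X_sub_one_le p) h).trans (by omega)
  · have h := MvPolynomial.aeval_natDegree_le (sectionSevenGs p P) le_rfl
      (![Polynomial.X, 0] : Fin 2 → Polynomial (AlgebraicClosure (ZMod p))) (n := 1)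
      (by intro i; fin_cases i <;> simp)
    rw [mul_one] at h
    refine le_trans (le_of_eq ?_) h
    have hP0 : P ≠ 0 := by
      rintro rfl
      simp at hP
    have hA : MvPolynomial.aeval (![Polynomial.X, 0] : Fin 2 → Polynomial _)
        (sectionSevenGs p P) = Polynomial.X * P ^ p + (Polynomial.X - 1) * P := by
      simp [sectionSevenGs_eq, ← Polynomial.aeval_algHom_apply]
    have h1 : (Polynomial.X * P ^ p).natDegree = p * P.natDegree + 1 := by
      rw [Polynomial.natDegree_X_mul (pow_ne_zero _ hP0), Polynomial.natDegree_pow]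
    have h2 : ((Polynomial.X - 1) * P).natDegree ≤ 1 + P.natDegree :=
      Polynomial.natDegree_mul_le_of_le
        ((Polynomial.natDegree_sub_le _ _).trans (by simp)) le_rfl
    rw [hA, Polynomial.natDegree_add_eq_left_of_natDegree_lt (by omega), h1]

/-- Section 7: in characteristic `p`, with `q = p^s`, `s ≥ 2`, `G(x,y) = xy^p + (x-1)y`
and `P ∈ F_q[x]` with `2 ≤ deg P ≤ q/p - 1`, the automorphism `g(x,y) = (x, y - P(x))`
of `𝔸²` conjugates `f₁(x,y) = (x^q, y^q + G(x,y))` to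
`f₂(x,y) = (x^q, y^q + G(x, y+P(x)))`; moreover `deg G < deg G(x,y+P(x)) < q`, and both
`f₁` and `f₂` extend to endomorphisms of `ℙ²` of degree `q`. -/
theorem char_p_conjugacy_example (p s q : ℕ) [Fact p.Prime] (hs : 2 ≤ s) (hq : q = p ^ s)
    (P : Polynomial (AlgebraicClosure (ZMod p)))
    -- `P` has coefficients in `F_q ⊂ k`
    (hPq : ∀ i, P.coeff i ^ q = P.coeff i)
    (hP2 : 2 ≤ P.natDegree) (hP3 : P.natDegree ≤ q / p - 1) :
    -- `g ∘ f₁ = f₂ ∘ g`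
    (∀ x y : AlgebraicClosure (ZMod p),
      (x ^ q, (y ^ q + eval ![x, y] (sectionSevenG p)) - P.eval (x ^ q)) =
        (x ^ q, (y - P.eval x) ^ q + eval ![x, y - P.eval x] (sectionSevenGs p P))) ∧
    -- `deg G < deg G(x, y+P(x)) < q`
    (sectionSevenG p).totalDegree < (sectionSevenGs p P).totalDegree ∧
    (sectionSevenGs p P).totalDegree < q ∧
    -- `f₁` and `f₂` have degree `q` ...
    max (X 0 ^ q : MvPolynomial (Fin 2) (AlgebraicClosure (ZMod p))).totalDegree
        (X 1 ^ q + sectionSevenG p).totalDegree = q ∧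
    max (X 0 ^ q : MvPolynomial (Fin 2) (AlgebraicClosure (ZMod p))).totalDegree
        (X 1 ^ q + sectionSevenGs p P).totalDegree = q ∧
    -- ... and extend to endomorphisms of `ℙ²` of degree `q`: the degree-`q` homogeneous
    -- parts of their components have no common zero outside the origin
    (∀ v : Fin 2 → AlgebraicClosure (ZMod p), v ≠ 0 →
      ¬(eval v (homogeneousComponent q (X 0 ^ q)) = 0 ∧
        eval v (homogeneousComponent q (X 1 ^ q + sectionSevenG p)) = 0)) ∧
    (∀ v : Fin 2 → AlgebraicClosure (ZMod p), v ≠ 0 →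
      ¬(eval v (homogeneousComponent q (X 0 ^ q)) = 0 ∧
        eval v (homogeneousComponent q (X 1 ^ q + sectionSevenGs p P)) = 0)) := by
  have hp := (Fact.out : p.Prime).two_le
  have hGs := totalDegree_sectionSevenGs p P (by omega)
  have hlt : (sectionSevenG p).totalDegree < (sectionSevenGs p P).totalDegree := by
    have := totalDegree_sectionSevenG_le p
    rw [hGs]
    nlinarith
  have hltq : (sectionSevenGs p P).totalDegree < q := by
    have h1 : p * (P.natDegree + 1) ≤ p * (q / p) := Nat.mul_le_mul_left p (by omega)
    have h2 := Nat.mul_div_le q p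
    rw [mul_add] at h1
    omega
  refine ⟨fun x y => ?_, hlt, hltq, max_totalDegree_X_pow_add 0 1 (hlt.trans hltq),
    max_totalDegree_X_pow_add 0 1 hltq, leading_forms_no_common_zero (hlt.trans hltq),
    leading_forms_no_common_zero hltq⟩
  subst hq
  rw [eval_sectionSevenGs, sub_add_cancel, sub_pow_char_pow,
    Polynomial.eval_pow_expChar_pow p s P hPq]
  congr 1
  ring
end

section
/- Let p be a prime, s ≥ 2 an integer, q = p^s, and k an algebraic closure of F_p. Define F̃₁ : k³ → k³ by F̃₁(x,y,z) = (x^q, y^q + z^{q−p−1} x y^p + z^{q−2}(x−z) y, z^q), a homogeneous lift of the endomorphism f₁ of P²_k extending (x,y) ↦ (x^q, y^q + x y^p + (x−1)y). Let ℓ(x,y,z) = αx + βy + γz be a nonzero linear form over k. Then there exists λ ∈ k^× with ℓ(F̃₁(v)) = λ·ℓ(v)^q for all v ∈ k³ (i.e. the line {ℓ = 0} is totally invariant under f₁) if and only if ℓ is proportional to z or to x − a z for some a ∈ F_q. In other words, the totally invariant lines of f₁ are exactly the lines L_a = {x = a z} with a ∈ F_q together with the line at infinity L_∞ = {z = 0}.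 -/
/-- Section 7: the totally invariant lines of
`f₁(x,y) = (x^q, y^q + xy^p + (x-1)y)`, with homogeneous lift
`F̃₁(x,y,z) = (x^q, y^q + z^{q-p-1}xy^p + z^{q-2}(x-z)y, z^q)`, are exactly the lines
`L_a = {x = az}` for `a ∈ F_q` together with the line at infinity `L_∞ = {z = 0}`:
a nonzero linear form `ℓ = αx + βy + γz` satisfies `ℓ ∘ F̃₁ = λ·ℓ^q` for some `λ ≠ 0`
iff `ℓ` is proportional to `z` or to `x - az` with `a ∈ F_q`. -/
theorem char_p_totally_invariant_lines (p s q : ℕ) [Fact p.Prime] (hs : 2 ≤ s)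
    (hq : q = p ^ s)
    (α β γ : AlgebraicClosure (ZMod p)) (hne : ¬(α = 0 ∧ β = 0 ∧ γ = 0)) :
    (∃ lam : AlgebraicClosure (ZMod p), lam ≠ 0 ∧
      ∀ x y z : AlgebraicClosure (ZMod p),
        α * x ^ q +
            β * (y ^ q + z ^ (q - p - 1) * x * y ^ p + z ^ (q - 2) * (x - z) * y) +
            γ * z ^ q =
          lam * (α * x + β * y + γ * z) ^ q) ↔
      ((α = 0 ∧ β = 0) ∨
        (β = 0 ∧ α ≠ 0 ∧ ∃ a : AlgebraicClosure (ZMod p), a ^ q = a ∧ γ = -α * a)) := by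
  have hp : 2 ≤ p := (Fact.out : p.Prime).two_le
  have hle : p * 2 ≤ q := by
    rw [hq]
    calc p * 2 ≤ p ^ 2 := by nlinarith
      _ ≤ p ^ s := Nat.pow_le_pow_right (by omega) hs
  have hq0 : q ≠ 0 := by omega
  have hp0 : p ≠ 0 := by omega
  have hadd (a b : AlgebraicClosure (ZMod p)) : (a + b) ^ q = a ^ q + b ^ q := by
    rw [hq]; exact add_pow_char_pow a b p s
  have hneg (a : AlgebraicClosure (ZMod p)) : (-a) ^ q = -a ^ q := by
    have h := hadd a (-a)
    rw [add_neg_cancel, zero_pow hq0] at h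
    linear_combination -h
  simp only [hadd, mul_pow]
  constructor
  · rintro ⟨lam, hlam, h⟩
    have hx := h 1 0 0
    have hy := h 0 1 0
    have hz := h 0 0 1
    have hyz := h 0 1 1
    have h2 : q - 2 ≠ 0 := by omega
    simp only [zero_pow hq0, zero_pow hp0, zero_pow h2, one_pow, mul_zero, zero_mul, mul_one,
      add_zero, zero_add, zero_sub] at hx hy hz hyz
    have hβ : β = 0 := by linear_combination -hyz + hy + hz
    by_cases hα : α = 0
    · exact Or.inl ⟨hα, hβ⟩
    · refine Or.inr ⟨hβ, hα, -(γ / α), ?_, by field_simp⟩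
      have hαq : α ^ q ≠ 0 := pow_ne_zero q hα
      rw [hneg, div_pow, neg_inj, div_eq_div_iff hαq hα]
      apply mul_left_cancel₀ hlam
      linear_combination γ * hx - α * hz
  · rintro (⟨rfl, rfl⟩ | ⟨rfl, hα, a, ha, rfl⟩)
    · have hγ : γ ≠ 0 := fun h => hne ⟨rfl, rfl, h⟩
      have hγq : γ ^ q ≠ 0 := pow_ne_zero q hγ
      refine ⟨γ / γ ^ q, div_ne_zero hγ hγq, fun x y z => ?_⟩
      simp only [zero_pow hq0, zero_mul, zero_add]
      field_simp
    · have hαq : α ^ q ≠ 0 := pow_ne_zero q hα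
      refine ⟨α / α ^ q, div_ne_zero hα hαq, fun x y z => ?_⟩
      rw [mul_pow, hneg, ha, zero_pow hq0]
      field_simp
      ring
end

section
/- Let p be a prime, s ≥ 2 an integer, q = p^s, and k an algebraic closure of F_p. For a ∈ F_q define φ_a(y) = y^q + a y^p + (a−1) y. Then for a ∈ F_q there exist α ∈ k^× and β ∈ k such that, with h(y) = αy + β, one has h(φ_a(y)) = (h(y))^q + (h(y))^p for all y if and only if a = 1; that is, a = 1 is the unique parameter a ∈ F_q for which φ_a is conjugate to y ↦ y^q + y^p by an affine map of A¹_k. -/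
open Polynomial in
/-- If two `p`-polynomials over an infinite field of characteristic `p` are conjugate by an affine
map and the second has no linear term, then neither does the first. -/
theorem linear_coeff_eq_zero_of_affine_conj {K : Type*} [Field K] [Infinite K] (p s : ℕ)
    [Fact p.Prime] [CharP K p] (hs : s ≠ 0) {a b α β : K} (hα : α ≠ 0)
    (h : ∀ y : K, α * (y ^ p ^ s + a * y ^ p + b * y) + β =
      (α * y + β) ^ p ^ s + (α * y + β) ^ p) : b = 0 := by
  have hp : p ≠ 1 := (Fact.out : p.Prime).ne_one
  have hp0 : p ≠ 0 := (Fact.out : p.Prime).ne_zero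
  have hq : p ^ s ≠ 1 := by simp [hp, hs]
  have hβ : β = β ^ p ^ s + β ^ p := by simpa [hp0] using h 0
  have key : C α * (X ^ p ^ s + C a * X ^ p + C b * X) =
      C (α ^ p ^ s) * X ^ p ^ s + C (α ^ p) * X ^ p := by
    refine Polynomial.funext fun y ↦ ?_
    have hy := h y
    rw [add_pow_char_pow, add_pow_char, mul_pow, mul_pow] at hy
    simp only [eval_mul, eval_add, eval_C, eval_pow, eval_X]
    linear_combination hy - hβ
  have hcoeff := congrArg (fun P : K[X] ↦ P.coeff 1) key
  simpa [coeff_X_pow, coeff_X, hp.symm, hq.symm, hα, -map_pow] using hcoeff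

/-- Section 7: `a = 1` is the unique parameter `a ∈ F_q` for which the restriction
`φ_a(y) = y^q + a y^p + (a-1) y` of `f₁` to the invariant line `{x = a}` is conjugate to
`y ↦ y^q + y^p` by an affine map `h(y) = αy + β` of `𝔸¹`. -/
theorem char_p_fiber_conjugate_to_additive_iff (p s q : ℕ) [Fact p.Prime]
    (hs : 2 ≤ s) (hq : q = p ^ s)
    (a : AlgebraicClosure (ZMod p)) (ha : a ^ q = a) :
    (∃ (α β : AlgebraicClosure (ZMod p)), α ≠ 0 ∧
      ∀ y : AlgebraicClosure (ZMod p),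
        α * (y ^ q + a * y ^ p + (a - 1) * y) + β =
          (α * y + β) ^ q + (α * y + β) ^ p) ↔ a = 1 := by
  subst hq
  constructor
  · rintro ⟨α, β, hα, h⟩
    exact sub_eq_zero.mp (linear_coeff_eq_zero_of_affine_conj p s (by lia) hα h)
  · rintro rfl
    exact ⟨1, 0, one_ne_zero, fun y ↦ by simp⟩
end
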